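/- arXiv:2505.12559 — 6 statements merged into one kernel-verified Lean document; each statement's English description precedes it below -/
import Mathlib

section
/- Let n ≥ 1 be an integer and let p, q ∈ ℝ with 1 < p, q < ∞ and 1/p + 1/q = 1. Let N ∈ ℕ and for each k ≤ N let A_k be a continuous linear functional on the space of continuous k-multilinear maps from EuclideanSpace ℝ (Fin n) to ℝ; define ω(φ) := ∑_{k=0}^{N} A_k (iteratedFDeriv ℝ k φ 0) for smooth compactly supported φ : EuclideanSpace ℝ (Fin n) → ℝ. Assume there is C ≥ 0 such that |ω(φ)| ≤ C·( ‖φ‖_{L^q} + ‖x ↦ ‖fderiv ℝ φ x‖‖_{L^q} + ‖x ↦ ‖iteratedFDeriv ℝ 2 φ x‖‖_{L^q} ) for every such φ. Then: (i) if n ≥ 3 and p ≥ n/(n−2), ω(φ) = 0 for all φ; (ii) if p ≥ n/(n−1), there exists c₀ ∈ ℝ with ω(φ) = c₀·φ(0) for all φ; (iii) if 1 < p < n/(n−1), there exist c₀ ∈ ℝ and c ∈ EuclideanSpace ℝ (Fin n) with ω(φ) = c₀·φ(0) + ⟪c, ∇φ(0)⟫ for all φ. -/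
open MeasureTheory Real Topology
open scoped RealInnerProductSpace

section Scaling

variable {E F : Type*} [NormedAddCommGroup E] [NormedSpace ℝ E] [FiniteDimensional ℝ E]
  [MeasurableSpace E] [BorelSpace E] {μ : Measure E} [μ.IsAddHaarMeasure]
  [NormedAddCommGroup F]

/-- `L^q`-norm of a dilated function. -/
theorem toReal_eLpNorm_comp_const_smul (f : E → F) {q r : ℝ} (hq : 0 < q) (hr : 0 < r) :
    (eLpNorm (fun x => f (r • x)) (ENNReal.ofReal q) μ).toReal =
      r ^ (-((Module.finrank ℝ E : ℝ) / q)) * (eLpNorm f (ENNReal.ofReal q) μ).toReal := by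
  have he : MeasurableEmbedding (fun x : E => r • x) :=
    (Homeomorph.smulOfNeZero r hr.ne').measurableEmbedding
  have h := he.eLpNorm_map_measure (g := f) (p := ENNReal.ofReal q) (μ := μ)
  have h0 : 0 < r ^ Module.finrank ℝ E := by positivity
  have hc : (f ∘ fun x : E => r • x) = fun x => f (r • x) := rfl
  rw [hc] at h
  rw [← h, Measure.map_addHaar_smul μ hr.ne', eLpNorm_smul_measure_of_ne_top (by simp),
    smul_eq_mul, ENNReal.toReal_mul, ← ENNReal.toReal_rpow,
    ENNReal.toReal_ofReal (abs_nonneg _), abs_of_pos (inv_pos.2 h0), ← Real.rpow_natCast,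
    ← Real.rpow_neg hr.le, ← Real.rpow_mul hr.le]
  · congr 2
    simp [div_eq_mul_inv, hq.le]

variable [NormedSpace ℝ F]

/-- Scaling of the `L^q`-norms of the iterated derivatives under dilations. -/
theorem toReal_eLpNorm_iteratedFDeriv_comp_const_smul {f : E → F} {i : ℕ} (hf : ContDiff ℝ i f)
    {q r : ℝ} (hq : 0 < q) (hr : 0 < r) :
    (eLpNorm (iteratedFDeriv ℝ i fun x => f (r • x)) (ENNReal.ofReal q) μ).toReal =
      r ^ ((i : ℝ) - (Module.finrank ℝ E : ℝ) / q) *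
        (eLpNorm (iteratedFDeriv ℝ i f) (ENNReal.ofReal q) μ).toReal := by
  rw [iteratedFDeriv_comp_const_smul r hf]
  have h : eLpNorm (fun x => r ^ i • iteratedFDeriv ℝ i f (r • x)) (ENNReal.ofReal q) μ =
      ‖r ^ i‖ₑ * eLpNorm (fun x => iteratedFDeriv ℝ i f (r • x)) (ENNReal.ofReal q) μ :=
    eLpNorm_const_smul (r ^ i) (fun x => iteratedFDeriv ℝ i f (r • x)) _ _
  rw [h, ENNReal.toReal_mul, toReal_eLpNorm_comp_const_smul _ hq hr,
    ← mul_assoc, sub_eq_add_neg, Real.rpow_add hr, Real.rpow_natCast]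
  simp [abs_of_pos hr]

end Scaling

/-- A polynomial which is `O(r ^ s)` at infinity has no coefficient of degree above `s`. -/
theorem Polynomial.coeff_eq_zero_of_abs_eval_le (P : Polynomial ℝ) {K s : ℝ}
    (h : ∀ r : ℝ, 1 ≤ r → |P.eval r| ≤ K * r ^ s) {k : ℕ} (hk : s < k) : P.coeff k = 0 := by
  by_contra hne
  have hd : s < P.natDegree := hk.trans_le (by exact_mod_cast P.le_natDegree_of_ne_zero hne)
  have hP : P ≠ 0 := by rintro rfl; simp at hne
  have h1 : (fun r : ℝ => r ^ P.natDegree) =O[Filter.atTop] fun r => P.eval r :=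
    ((Asymptotics.isBigO_refl _ _).const_mul_right'
      (Polynomial.leadingCoeff_ne_zero.2 hP).isUnit).trans P.isEquivalent_atTop_lead.isBigO_symm
  have h2 : (fun r : ℝ => P.eval r) =O[Filter.atTop] fun r : ℝ => r ^ s := by
    refine Asymptotics.IsBigO.of_bound K ?_
    filter_upwards [Filter.eventually_ge_atTop 1] with r hr
    rw [Real.norm_eq_abs, Real.norm_of_nonneg (by positivity)]
    exact h r hr
  have h3 : (fun r : ℝ => r ^ s) =o[Filter.atTop] fun r : ℝ => r ^ P.natDegree := by
    rw [Asymptotics.isLittleO_iff_tendsto']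
    · refine (tendsto_rpow_neg_atTop (sub_pos.2 hd)).congr' ?_
      filter_upwards [Filter.eventually_gt_atTop 0] with r hr
      rw [neg_sub, Real.rpow_sub hr, Real.rpow_natCast]
    · filter_upwards [Filter.eventually_gt_atTop 0] with r hr h
      exact absurd h (pow_pos hr _).ne'
  have h4 := (h1.trans h2).trans_isLittleO h3
  obtain ⟨r, hr, hr0⟩ := ((h4.def (c := 1 / 2) (by norm_num)).and
    (Filter.eventually_gt_atTop 0)).exists
  have : 0 < ‖r ^ P.natDegree‖ := norm_pos_iff.2 (pow_pos hr0 _).ne'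
  linarith

/-- Minkowski's inequality for the real-valued `L^p`-norms of finitely many functions. -/
theorem toReal_eLpNorm_sum_le {α ι F : Type*} [MeasurableSpace α] {μ : Measure α}
    [NormedAddCommGroup F] {p : ENNReal} (hp : 1 ≤ p) (s : Finset ι) (f : ι → α → F)
    (hf : ∀ j ∈ s, MemLp (f j) p μ) :
    (eLpNorm (∑ j ∈ s, f j) p μ).toReal ≤ ∑ j ∈ s, (eLpNorm (f j) p μ).toReal := by
  rw [← ENNReal.toReal_sum fun j hj => (hf j hj).eLpNorm_ne_top]
  exact ENNReal.toReal_mono (ENNReal.sum_ne_top.2 fun j hj => (hf j hj).eLpNorm_ne_top)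
    (eLpNorm_sum_le (fun j hj => (hf j hj).1) hp)

/-- The `L^q`-norm of a sum of functions with pairwise disjoint supports. -/
theorem eLpNorm_sum_eq_of_disjoint_support {α ι F : Type*} [MeasurableSpace α] {μ : Measure α}
    [NormedAddCommGroup F] {q : ℝ} (hq : 0 < q) (s : Finset ι) (f : ι → α → F)
    (hf : ∀ j ∈ s, AEStronglyMeasurable (f j) μ)
    (hd : ∀ x, ∀ i ∈ s, ∀ j ∈ s, f i x ≠ 0 → f j x ≠ 0 → i = j) :
    eLpNorm (∑ j ∈ s, f j) (ENNReal.ofReal q) μ =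
      (∑ j ∈ s, eLpNorm (f j) (ENNReal.ofReal q) μ ^ q) ^ (1 / q) := by
  have key : ∀ g : α → F, eLpNorm g (ENNReal.ofReal q) μ = (∫⁻ x, ‖g x‖ₑ ^ q ∂μ) ^ (1 / q) := by
    intro g
    rw [eLpNorm_eq_lintegral_rpow_enorm_toReal (by simpa using hq) (by simp),
      ENNReal.toReal_ofReal hq.le]
  have hpt : ∀ x, ‖(∑ j ∈ s, f j) x‖ₑ ^ q = ∑ j ∈ s, ‖f j x‖ₑ ^ q := by
    intro x
    rw [Finset.sum_apply]
    by_cases h : ∃ i ∈ s, f i x ≠ 0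
    · obtain ⟨i, hi, hne⟩ := h
      have h0 : ∀ j ∈ s, j ≠ i → f j x = 0 := fun j hj hji => by
        by_contra hj0
        exact hji (hd x j hj i hi hj0 hne)
      rw [Finset.sum_eq_single_of_mem i hi h0, Finset.sum_eq_single_of_mem i hi]
      intro j hj hji
      simp [h0 j hj hji, hq]
    · push Not at h
      rw [Finset.sum_eq_zero h, Finset.sum_eq_zero]
      · simp [hq]
      · intro j hj
        simp [h j hj, hq]
  rw [key]
  simp_rw [hpt, key]
  rw [lintegral_finsetSum' _ fun j hj => ((hf j hj).enorm.pow_const q)]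
  congr 1
  refine Finset.sum_congr rfl fun j _ => ?_
  rw [← ENNReal.rpow_mul, one_div_mul_cancel hq.ne', ENNReal.rpow_one]

section Lacunary

variable {E : Type*} [NormedAddCommGroup E] [NormedSpace ℝ E]

/-- The dilate `x ↦ φ (r x)`, normalized so that its derivative of order `k` at the origin does
not depend on `r`. -/
noncomputable def dilate (k : ℕ) (r : ℝ) (φ : E → ℝ) (x : E) : ℝ :=
  (r ^ k)⁻¹ • φ (r • x)

/-- The sum of the normalized dilates by `1, 4, …, 4 ^ (m - 1)`. -/
noncomputable def lacunarySum (k m : ℕ) (φ : E → ℝ) (x : E) : ℝ :=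
  ∑ j ∈ Finset.range m, dilate k (4 ^ j) φ x

theorem ContDiff.dilate {φ : E → ℝ} {N : ℕ∞} (hφ : ContDiff ℝ N φ) (k : ℕ) (r : ℝ) :
    ContDiff ℝ N (dilate k r φ) :=
  (hφ.comp (contDiff_const_smul r)).const_smul _

theorem HasCompactSupport.dilate {φ : E → ℝ} (hφ : HasCompactSupport φ) (k : ℕ) {r : ℝ}
    (hr : r ≠ 0) : HasCompactSupport (dilate k r φ) :=
  (hφ.comp_smul hr).smul_left (f := fun _ => (r ^ k)⁻¹)

theorem ContDiff.lacunarySum {φ : E → ℝ} {N : ℕ∞} (hφ : ContDiff ℝ N φ) (k m : ℕ) :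
    ContDiff ℝ N (lacunarySum k m φ) :=
  ContDiff.sum fun _ _ => hφ.dilate k _

theorem HasCompactSupport.lacunarySum {φ : E → ℝ} (hφ : HasCompactSupport φ) (k m : ℕ) :
    HasCompactSupport (lacunarySum k m φ) := by
  induction m with
  | zero =>
    have : _root_.lacunarySum k 0 φ = 0 := by ext; simp [_root_.lacunarySum]
    rw [this]
    exact HasCompactSupport.zero
  | succ m ih =>
    have : _root_.lacunarySum k (m + 1) φ =
        _root_.lacunarySum k m φ + _root_.dilate k (4 ^ m) φ := by
      ext
      simp [_root_.lacunarySum, Finset.sum_range_succ]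
    rw [this]
    exact ih.add (hφ.dilate k (by positivity))

theorem iteratedFDeriv_dilate {φ : E → ℝ} {i : ℕ} (hφ : ContDiff ℝ i φ) (k : ℕ) (r : ℝ) (x : E) :
    iteratedFDeriv ℝ i (dilate k r φ) x =
      ((r ^ k)⁻¹ * r ^ i) • iteratedFDeriv ℝ i φ (r • x) := by
  have h : ContDiff ℝ i fun x => φ (r • x) := hφ.comp (contDiff_const_smul r)
  have := iteratedFDeriv_const_smul_apply' (a := (r ^ k)⁻¹) (h.contDiffAt (x := x))
  rw [mul_smul]
  refine this.trans ?_
  rw [iteratedFDeriv_comp_const_smul r hφ]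

theorem iteratedFDeriv_lacunarySum {φ : E → ℝ} {i : ℕ} (hφ : ContDiff ℝ i φ) (k m : ℕ) :
    iteratedFDeriv ℝ i (lacunarySum k m φ) =
      ∑ j ∈ Finset.range m, iteratedFDeriv ℝ i (dilate k (4 ^ j) φ) :=
  iteratedFDeriv_sum fun _ _ => ContDiff.dilate (N := i) hφ k _

theorem ContDiff.memLp_iteratedFDeriv [MeasurableSpace E] [BorelSpace E]
    [SecondCountableTopology E] {μ : Measure E} [IsFiniteMeasureOnCompacts μ] {φ : E → ℝ} {i : ℕ} (hφ : ContDiff ℝ i φ)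
    (hc : HasCompactSupport φ) (p : ENNReal) : MemLp (iteratedFDeriv ℝ i φ) p μ :=
  (hφ.continuous_iteratedFDeriv le_rfl).memLp_of_hasCompactSupport (hc.iteratedFDeriv i)

variable [FiniteDimensional ℝ E] [MeasurableSpace E] [BorelSpace E] {μ : Measure E}
  [μ.IsAddHaarMeasure]

theorem toReal_eLpNorm_iteratedFDeriv_dilate {φ : E → ℝ} {i : ℕ} (hφ : ContDiff ℝ i φ) (k : ℕ)
    {q r : ℝ} (hq : 0 < q) (hr : 0 < r) :
    (eLpNorm (iteratedFDeriv ℝ i (dilate k r φ)) (ENNReal.ofReal q) μ).toReal =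
      r ^ ((i : ℝ) - k - (Module.finrank ℝ E : ℝ) / q) *
        (eLpNorm (iteratedFDeriv ℝ i φ) (ENNReal.ofReal q) μ).toReal := by
  have h : iteratedFDeriv ℝ i (dilate k r φ) = fun x =>
      (r ^ k)⁻¹ • iteratedFDeriv ℝ i (fun x => φ (r • x)) x := by
    ext1 x
    rw [iteratedFDeriv_dilate hφ, iteratedFDeriv_comp_const_smul r hφ, mul_smul]
  have h' := eLpNorm_const_smul (r ^ k)⁻¹ (iteratedFDeriv ℝ i fun x => φ (r • x))
    (ENNReal.ofReal q) μ
  rw [h]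
  refine (congrArg ENNReal.toReal h').trans ?_
  rw [ENNReal.toReal_mul, toReal_eLpNorm_iteratedFDeriv_comp_const_smul hφ hq hr, ← mul_assoc,
    show (i : ℝ) - k - (Module.finrank ℝ E : ℝ) / q =
      -k + (i - (Module.finrank ℝ E : ℝ) / q) by ring, Real.rpow_add hr, Real.rpow_neg hr.le,
    Real.rpow_natCast]
  simp [abs_of_pos hr]

/-- In the critical case the lower order derivatives of the lacunary sums stay bounded. -/
theorem toReal_eLpNorm_iteratedFDeriv_lacunarySum_le {φ : E → ℝ} {i : ℕ} (hi : i < 2)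
    (hφ : ContDiff ℝ i φ) (hc : HasCompactSupport φ) {k : ℕ} (m : ℕ) {q : ℝ} (hq : 1 ≤ q)
    (hk : (Module.finrank ℝ E : ℝ) / q = 2 - k) :
    (eLpNorm (iteratedFDeriv ℝ i (lacunarySum k m φ)) (ENNReal.ofReal q) μ).toReal ≤
      2 * (eLpNorm (iteratedFDeriv ℝ i φ) (ENNReal.ofReal q) μ).toReal := by
  have hq0 : 0 < q := by linarith
  set G := (eLpNorm (iteratedFDeriv ℝ i φ) (ENNReal.ofReal q) μ).toReal with hG
  have hmem : ∀ j : ℕ,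
      MemLp (iteratedFDeriv ℝ i (dilate k (4 ^ j) φ)) (ENNReal.ofReal q) μ := fun j =>
    ContDiff.memLp_iteratedFDeriv (ContDiff.dilate (N := i) hφ k _)
      (hc.dilate k (by positivity)) _
  have hterm : ∀ j : ℕ, (eLpNorm (iteratedFDeriv ℝ i (dilate k (4 ^ j) φ))
      (ENNReal.ofReal q) μ).toReal ≤ (1 / 4) ^ j * G := by
    intro j
    rw [toReal_eLpNorm_iteratedFDeriv_dilate hφ k hq0 (by positivity), hk]
    refine mul_le_mul_of_nonneg_right ?_ ENNReal.toReal_nonneg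
    calc ((4 : ℝ) ^ j) ^ ((i : ℝ) - k - (2 - k)) ≤ ((4 : ℝ) ^ j) ^ (-1 : ℝ) := by
          refine Real.rpow_le_rpow_of_exponent_le (one_le_pow₀ (by norm_num)) ?_
          have : (i : ℝ) ≤ 1 := by exact_mod_cast Nat.lt_succ_iff.1 hi
          linarith
      _ = (1 / 4) ^ j := by rw [Real.rpow_neg_one, one_div, inv_pow]
  rw [iteratedFDeriv_lacunarySum hφ]
  calc _ ≤ ∑ j ∈ Finset.range m, (eLpNorm (iteratedFDeriv ℝ i (dilate k (4 ^ j) φ))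
        (ENNReal.ofReal q) μ).toReal :=
        toReal_eLpNorm_sum_le (by simpa using hq) _ _ fun j _ => hmem j
    _ ≤ ∑ j ∈ Finset.range m, (1 / 4) ^ j * G := Finset.sum_le_sum fun j _ => hterm j
    _ = (∑ j ∈ Finset.range m, (1 / 4 : ℝ) ^ j) * G := by rw [Finset.sum_mul]
    _ ≤ 2 * G := by
        refine mul_le_mul_of_nonneg_right ?_ ENNReal.toReal_nonneg
        have h := (summable_geometric_of_lt_one (r := (1 / 4 : ℝ)) (by norm_num)
          (by norm_num)).sum_le_tsum (Finset.range m) fun _ _ => by positivity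
        rw [tsum_geometric_of_lt_one (by norm_num) (by norm_num)] at h
        linarith

/-- In the critical case the second derivatives of the lacunary sums grow only like
`m ^ (1 / q)`. -/
theorem toReal_eLpNorm_iteratedFDeriv_two_lacunarySum {φ : E → ℝ} (hφ : ContDiff ℝ 2 φ)
    (hc : HasCompactSupport φ)
    (hsupp : ∀ x, iteratedFDeriv ℝ 2 φ x ≠ 0 → 1 ≤ ‖x‖ ∧ ‖x‖ ≤ 2) {k : ℕ} (m : ℕ) {q : ℝ}
    (hq : 1 ≤ q) (hk : (Module.finrank ℝ E : ℝ) / q = 2 - k) :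
    (eLpNorm (iteratedFDeriv ℝ 2 (lacunarySum k m φ)) (ENNReal.ofReal q) μ).toReal =
      (m : ℝ) ^ (1 / q) * (eLpNorm (iteratedFDeriv ℝ 2 φ) (ENNReal.ofReal q) μ).toReal := by
  have hq0 : 0 < q := by linarith
  have hmem : ∀ j : ℕ,
      MemLp (iteratedFDeriv ℝ 2 (dilate k (4 ^ j) φ)) (ENNReal.ofReal q) μ := fun j =>
    ContDiff.memLp_iteratedFDeriv (ContDiff.dilate (N := 2) hφ k _)
      (hc.dilate k (by positivity)) _
  have hterm : ∀ j : ℕ, eLpNorm (iteratedFDeriv ℝ 2 (dilate k (4 ^ j) φ))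
      (ENNReal.ofReal q) μ = eLpNorm (iteratedFDeriv ℝ 2 φ) (ENNReal.ofReal q) μ := by
    intro j
    rw [← ENNReal.toReal_eq_toReal_iff' (hmem j).eLpNorm_ne_top
      (ContDiff.memLp_iteratedFDeriv hφ hc _).eLpNorm_ne_top,
      toReal_eLpNorm_iteratedFDeriv_dilate hφ k hq0 (by positivity), hk]
    simp
  rw [iteratedFDeriv_lacunarySum hφ,
    eLpNorm_sum_eq_of_disjoint_support hq0 _ _ fun j _ => (hmem j).1]
  · simp_rw [hterm]
    rw [Finset.sum_const, Finset.card_range, nsmul_eq_mul,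
      ENNReal.mul_rpow_of_nonneg _ _ (by positivity), ← ENNReal.rpow_mul,
      mul_one_div_cancel hq0.ne', ENNReal.rpow_one, ENNReal.toReal_mul, ← ENNReal.toReal_rpow,
      ENNReal.toReal_natCast]
  · intro x
    have hne : ∀ j : ℕ, iteratedFDeriv ℝ 2 (dilate k (4 ^ j) φ) x ≠ 0 →
        1 ≤ (4 : ℝ) ^ j * ‖x‖ ∧ (4 : ℝ) ^ j * ‖x‖ ≤ 2 := by
      intro j hj
      rw [iteratedFDeriv_dilate hφ] at hj
      have := hsupp _ (right_ne_zero_of_smul hj)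
      rwa [norm_smul, norm_pow, Real.norm_of_nonneg (by norm_num : (0 : ℝ) ≤ 4)] at this
    have hlt : ∀ i j : ℕ, i < j → 1 ≤ (4 : ℝ) ^ i * ‖x‖ → (4 : ℝ) ^ j * ‖x‖ ≤ 2 → False := by
      intro i j hij h1 h2
      have h3 : (4 : ℝ) ^ (i + 1) ≤ 4 ^ j := pow_le_pow_right₀ (by norm_num) hij
      have h4 := mul_le_mul_of_nonneg_right h3 (norm_nonneg x)
      rw [pow_succ] at h4
      linarith
    intro i _ j _ hi hj
    rcases lt_trichotomy i j with h | h | h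
    · exact (hlt i j h (hne i hi).1 (hne j hj).2).elim
    · exact h
    · exact (hlt j i h (hne j hj).1 (hne i hi).2).elim

end Lacunary

section DistributionSupportedAtZero

variable {E : Type*} [NormedAddCommGroup E] [NormedSpace ℝ E]

theorem iteratedFDeriv_two_const_add_clm (c : ℝ) (L : E →L[ℝ] ℝ) (x : E) :
    iteratedFDeriv ℝ 2 (fun y => c + L y) x = 0 := by
  have h : fderiv ℝ (fun y => c + L y) = fun _ => L := by
    ext1 y
    simp
  ext v
  rw [iteratedFDeriv_two_apply, h]
  simp

variable [FiniteDimensional ℝ E]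

/-- Every affine function agrees near the origin with a test function whose second derivatives
live in the shell `1 ≤ ‖x‖ ≤ 2`. -/
theorem exists_affine_cutoff (c : ℝ) (L : E →L[ℝ] ℝ) :
    ∃ φ : E → ℝ, ContDiff ℝ (⊤ : ℕ∞) φ ∧ HasCompactSupport φ ∧
      (∀ x, iteratedFDeriv ℝ 2 φ x ≠ 0 → 1 ≤ ‖x‖ ∧ ‖x‖ ≤ 2) ∧
      φ =ᶠ[𝓝 0] fun x => c + L x := by
  let η : ContDiffBump (0 : E) := ⟨1, 2, one_pos, one_lt_two⟩
  let ψ : E → ℝ := fun x => c + L x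
  have hψ : ContDiff ℝ (⊤ : ℕ∞) ψ := contDiff_const.add L.contDiff
  have hev : ∀ x : E, ‖x‖ < 1 → (fun y => η y * ψ y) =ᶠ[𝓝 x] ψ := by
    intro x hx
    filter_upwards [η.eventuallyEq_one_of_mem_ball (mem_ball_zero_iff.2 hx)] with y hy
    simp [hy]
  refine ⟨fun x => η x * ψ x, η.contDiff.mul hψ, η.hasCompactSupport.mul_right, ?_,
    hev 0 (by simp)⟩
  intro x hx
  constructor
  · by_contra! h
    exact hx ((hev x h).iteratedFDeriv ℝ 2 |>.eq_of_nhds.trans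
      (iteratedFDeriv_two_const_add_clm c L x))
  · have h1 : x ∈ tsupport fun x => η x * ψ x := support_iteratedFDeriv_subset 2 hx
    have h2 := tsupport_mul_subset_left h1
    rw [η.tsupport_eq] at h2
    simpa using h2

variable [MeasurableSpace E] [BorelSpace E] {μ : Measure E} [μ.IsAddHaarMeasure]
  {M : ℕ} {A : (k : ℕ) → (ContinuousMultilinearMap ℝ (fun _ : Fin k => E) ℝ) →L[ℝ] ℝ}
  {C q : ℝ}

/-- A distribution supported at the origin and bounded by the `W^{2,q}`-norm has no component of
order above `2 - d / q`. -/
theorem apply_iteratedFDeriv_eq_zero_of_lt (hq : 1 < q) (hC : 0 ≤ C)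
    (hbound : ∀ φ : E → ℝ, ContDiff ℝ (⊤ : ℕ∞) φ → HasCompactSupport φ →
      |∑ k ∈ Finset.range M, A k (iteratedFDeriv ℝ k φ 0)| ≤
        C * ∑ i ∈ Finset.range 3,
          (eLpNorm (iteratedFDeriv ℝ i φ) (ENNReal.ofReal q) μ).toReal)
    {k : ℕ} (hkM : k < M) (hk : 2 - (Module.finrank ℝ E : ℝ) / q < k)
    {φ : E → ℝ} (hφ : ContDiff ℝ (⊤ : ℕ∞) φ) (hc : HasCompactSupport φ) :
    A k (iteratedFDeriv ℝ k φ 0) = 0 := by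
  have hq0 : 0 < q := by linarith
  have hφi : ∀ i : ℕ, ContDiff ℝ i φ := fun i => hφ.of_le (by exact_mod_cast le_top)
  let P : Polynomial ℝ :=
    ∑ k ∈ Finset.range M, Polynomial.monomial k (A k (iteratedFDeriv ℝ k φ 0))
  have hcoeff : P.coeff k = A k (iteratedFDeriv ℝ k φ 0) := by
    simp only [P, Polynomial.finsetSum_coeff, Polynomial.coeff_monomial]
    rw [Finset.sum_ite_eq' (Finset.range M) k]
    simp [hkM]
  rw [← hcoeff]
  refine P.coeff_eq_zero_of_abs_eval_le (K := C * ∑ i ∈ Finset.range 3,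
    (eLpNorm (iteratedFDeriv ℝ i φ) (ENNReal.ofReal q) μ).toReal) (fun r hr => ?_) hk
  have hr0 : 0 < r := by linarith
  have heval : P.eval r =
      ∑ k ∈ Finset.range M, A k (iteratedFDeriv ℝ k (fun x => φ (r • x)) 0) := by
    simp only [P, Polynomial.eval_finsetSum, Polynomial.eval_monomial]
    refine Finset.sum_congr rfl fun k _ => ?_
    rw [iteratedFDeriv_comp_const_smul r (hφi k)]
    simp [mul_comm]
  rw [heval]
  refine (hbound (fun x => φ (r • x)) (hφ.comp (contDiff_const_smul r)) (hc.comp_smul hr0.ne')).trans ?_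
  rw [mul_assoc, Finset.sum_mul]
  refine mul_le_mul_of_nonneg_left (Finset.sum_le_sum fun i hi => ?_) hC
  rw [toReal_eLpNorm_iteratedFDeriv_comp_const_smul (hφi i) hq0 hr0, mul_comm]
  refine mul_le_mul_of_nonneg_left ?_ ENNReal.toReal_nonneg
  refine Real.rpow_le_rpow_of_exponent_le hr ?_
  have : (i : ℝ) ≤ 2 := by exact_mod_cast Nat.lt_succ_iff.1 (Finset.mem_range.1 hi)
  linarith

/-- The critical order `k = 2 - d / q`, for test functions that are affine near the origin. -/
theorem apply_iteratedFDeriv_eq_zero_of_lacunary (hq : 1 < q) (hC : 0 ≤ C)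
    (hbound : ∀ φ : E → ℝ, ContDiff ℝ (⊤ : ℕ∞) φ → HasCompactSupport φ →
      |∑ k ∈ Finset.range M, A k (iteratedFDeriv ℝ k φ 0)| ≤
        C * ∑ i ∈ Finset.range 3,
          (eLpNorm (iteratedFDeriv ℝ i φ) (ENNReal.ofReal q) μ).toReal)
    {k : ℕ} (hkM : k < M) (hk : (Module.finrank ℝ E : ℝ) / q = 2 - k)
    {φ : E → ℝ} (hφ : ContDiff ℝ (⊤ : ℕ∞) φ) (hc : HasCompactSupport φ)
    (hsupp : ∀ x, iteratedFDeriv ℝ 2 φ x ≠ 0 → 1 ≤ ‖x‖ ∧ ‖x‖ ≤ 2)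
    (hother : ∀ l < M, l ≠ k → A l (iteratedFDeriv ℝ l φ 0) = 0) :
    A k (iteratedFDeriv ℝ k φ 0) = 0 := by
  have hq0 : 0 < q := by linarith
  have hφi : ∀ i : ℕ, ContDiff ℝ i φ := fun i => hφ.of_le (by exact_mod_cast le_top)
  set b := A k (iteratedFDeriv ℝ k φ 0) with hb
  set G : ℕ → ℝ := fun i => (eLpNorm (iteratedFDeriv ℝ i φ) (ENNReal.ofReal q) μ).toReal with hG
  have hG0 : ∀ i, 0 ≤ G i := fun i => ENNReal.toReal_nonneg
  have hval : ∀ m : ℕ,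
      ∑ l ∈ Finset.range M, A l (iteratedFDeriv ℝ l (lacunarySum k m φ) 0) = m * b := by
    intro m
    have hl : ∀ l, A l (iteratedFDeriv ℝ l (lacunarySum k m φ) 0) =
        ∑ j ∈ Finset.range m, ((((4 : ℝ) ^ j) ^ k)⁻¹ * ((4 : ℝ) ^ j) ^ l) *
          A l (iteratedFDeriv ℝ l φ 0) := by
      intro l
      rw [iteratedFDeriv_lacunarySum (hφi l), Finset.sum_apply, map_sum]
      refine Finset.sum_congr rfl fun j _ => ?_
      rw [iteratedFDeriv_dilate (hφi l), smul_zero, map_smul, smul_eq_mul]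
    rw [Finset.sum_eq_single_of_mem k (Finset.mem_range.2 hkM), hl]
    · simp [hb]
    · intro l hlM hlk
      rw [hl, hother l (Finset.mem_range.1 hlM) hlk]
      simp
  set K := C * (2 * G 0 + 2 * G 1 + G 2) with hK
  have hle : ∀ m : ℕ, 1 ≤ m → |b| * (m : ℝ) ^ (1 - 1 / q) ≤ K := by
    intro m hm
    have hm1 : (1 : ℝ) ≤ m := by exact_mod_cast hm
    have hm0 : (0 : ℝ) < m := by linarith
    have hpow : (1 : ℝ) ≤ (m : ℝ) ^ (1 / q) := Real.one_le_rpow hm1 (by positivity)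
    have h := hbound _ (hφ.lacunarySum k m) (hc.lacunarySum k m)
    have h0 := toReal_eLpNorm_iteratedFDeriv_lacunarySum_le (μ := μ) (i := 0) (by norm_num)
      (hφi 0) hc m hq.le hk
    have h1 := toReal_eLpNorm_iteratedFDeriv_lacunarySum_le (μ := μ) (i := 1) (by norm_num)
      (hφi 1) hc m hq.le hk
    have h2 := toReal_eLpNorm_iteratedFDeriv_two_lacunarySum (μ := μ) (hφi 2) hc hsupp m hq.le hk
    rw [hval, abs_mul, Nat.abs_cast, Finset.sum_range_succ, Finset.sum_range_succ,
      Finset.sum_range_one, h2] at h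
    have h3 : (m : ℝ) * |b| ≤ K * (m : ℝ) ^ (1 / q) := by
      refine h.trans ?_
      rw [hK, mul_assoc]
      refine mul_le_mul_of_nonneg_left ?_ hC
      have e0 := mul_le_mul_of_nonneg_left hpow (hG0 0)
      have e1 := mul_le_mul_of_nonneg_left hpow (hG0 1)
      simp only [hG] at e0 e1 ⊢
      linarith
    rw [Real.rpow_sub hm0, Real.rpow_one, mul_div_assoc', div_le_iff₀ (by linarith)]
    linarith
  by_contra hne
  have hlim : Filter.Tendsto (fun m : ℕ => |b| * (m : ℝ) ^ (1 - 1 / q)) Filter.atTop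
      Filter.atTop :=
    ((tendsto_rpow_atTop (sub_pos.2 ((div_lt_one hq0).2 hq))).comp
      tendsto_natCast_atTop_atTop).const_mul_atTop (abs_pos.2 hne)
  obtain ⟨m, hm, hm1⟩ := ((hlim.eventually_gt_atTop K).and
    (Filter.eventually_ge_atTop 1)).exists
  exact absurd (hle m hm1) (not_le.2 hm)

/-- A distribution supported at the origin and bounded by the `W^{2,q}`-norm has no component of
order at least `2 - d / q`. -/
theorem apply_iteratedFDeriv_eq_zero (hd : 0 < Module.finrank ℝ E) (hq : 1 < q) (hC : 0 ≤ C)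
    (hbound : ∀ φ : E → ℝ, ContDiff ℝ (⊤ : ℕ∞) φ → HasCompactSupport φ →
      |∑ k ∈ Finset.range M, A k (iteratedFDeriv ℝ k φ 0)| ≤
        C * ∑ i ∈ Finset.range 3,
          (eLpNorm (iteratedFDeriv ℝ i φ) (ENNReal.ofReal q) μ).toReal)
    {k : ℕ} (hkM : k < M) (hk : 2 - (Module.finrank ℝ E : ℝ) / q ≤ k)
    {φ : E → ℝ} (hφ : ContDiff ℝ (⊤ : ℕ∞) φ) (hc : HasCompactSupport φ) :
    A k (iteratedFDeriv ℝ k φ 0) = 0 := by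
  rcases hk.lt_or_eq with hlt | heq
  · exact apply_iteratedFDeriv_eq_zero_of_lt hq hC hbound hkM hlt hφ hc
  have hdq : 0 < (Module.finrank ℝ E : ℝ) / q :=
    div_pos (by exact_mod_cast hd) (by linarith)
  have hk2 : k < 2 := by
    have : (k : ℝ) < 2 := by linarith
    exact_mod_cast this
  suffices h : ∃ (c : ℝ) (L : E →L[ℝ] ℝ),
      iteratedFDeriv ℝ k φ 0 = iteratedFDeriv ℝ k (fun x => c + L x) 0 ∧
      ∀ l < k, iteratedFDeriv ℝ l (fun x => c + L x) 0 = 0 by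
    obtain ⟨c, L, hcL, hlow⟩ := h
    obtain ⟨χ, hχ, hχc, hsupp, hev⟩ := exists_affine_cutoff c L
    have hχD : ∀ l, iteratedFDeriv ℝ l χ 0 = iteratedFDeriv ℝ l (fun x => c + L x) 0 :=
      fun l => (hev.iteratedFDeriv ℝ l).eq_of_nhds
    rw [hcL, ← hχD]
    refine apply_iteratedFDeriv_eq_zero_of_lacunary hq hC hbound hkM (by linarith) hχ hχc hsupp ?_
    intro l hlM hlk
    rcases lt_or_gt_of_ne hlk with h | h
    · rw [hχD, hlow l h, map_zero]
    · refine apply_iteratedFDeriv_eq_zero_of_lt hq hC hbound hlM ?_ hχ hχc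
      rw [heq]
      exact_mod_cast h
  interval_cases k
  · refine ⟨φ 0, 0, ?_, by simp⟩
    ext v
    simp
  · refine ⟨0, fderiv ℝ φ 0, ?_, ?_⟩
    · ext v
      simp
    · intro l hl
      obtain rfl : l = 0 := by omega
      ext v
      simp

end DistributionSupportedAtZero

/-- A continuous linear functional of the first derivative at the origin is the pairing of the
gradient with a fixed vector. -/
theorem exists_apply_iteratedFDeriv_one_eq_inner_gradient {E : Type*} [NormedAddCommGroup E]
    [InnerProductSpace ℝ E] [CompleteSpace E]
    (B : (ContinuousMultilinearMap ℝ (fun _ : Fin 1 => E) ℝ) →L[ℝ] ℝ) :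
    ∃ c : E, ∀ φ : E → ℝ, B (iteratedFDeriv ℝ 1 φ 0) = ⟪c, gradient φ 0⟫ := by
  let J := (continuousMultilinearCurryFin1 ℝ E ℝ).symm.toContinuousLinearEquiv
  refine ⟨(InnerProductSpace.toDual ℝ E).symm
    (B ∘L J.toContinuousLinearMap ∘L innerSL ℝ), fun φ => ?_⟩
  rw [InnerProductSpace.toDual_symm_apply]
  have h : innerSL ℝ (gradient φ 0) = fderiv ℝ φ 0 :=
    (InnerProductSpace.toDual ℝ E).apply_symm_apply (fderiv ℝ φ 0)
  have h' : J (fderiv ℝ φ 0) = iteratedFDeriv ℝ 1 φ 0 := by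
    ext v
    simp [J]
  simp [h, h']

/-- Lemma 3.2 ("Lem"): a distribution supported at the origin, i.e. a finite combination
`ω(φ) = ∑_{k≤N} A_k (D^k φ(0))`, which is continuous w.r.t. the `W^{2,q}`-norm (hence
belongs to `W^{-2,p}(ℝⁿ)`), has all coefficients of order `≥ 2` vanishing; the order-one
part vanishes when `p ≥ n/(n−1)`, and the whole distribution vanishes when `n ≥ 3` and
`p ≥ n/(n−2)`. -/
theorem stmt1 (n : ℕ) (hn : 1 ≤ n) (p q : ℝ) (hp : 1 < p) (hq : 1 < q)
    (hpq : 1 / p + 1 / q = 1) (N : ℕ)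
    (A : (k : ℕ) →
      (ContinuousMultilinearMap ℝ (fun _ : Fin k => EuclideanSpace ℝ (Fin n)) ℝ) →L[ℝ] ℝ)
    (ω : (EuclideanSpace ℝ (Fin n) → ℝ) → ℝ)
    (hω : ∀ φ : EuclideanSpace ℝ (Fin n) → ℝ,
      ω φ = ∑ k ∈ Finset.range (N + 1), A k (iteratedFDeriv ℝ k φ 0))
    (C : ℝ) (hC : 0 ≤ C)
    (hbound : ∀ φ : EuclideanSpace ℝ (Fin n) → ℝ, ContDiff ℝ (⊤ : ℕ∞) φ → HasCompactSupport φ →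
      |ω φ| ≤ C * ((eLpNorm φ (ENNReal.ofReal q) volume).toReal +
        (eLpNorm (fun x => ‖fderiv ℝ φ x‖) (ENNReal.ofReal q) volume).toReal +
        (eLpNorm (fun x => ‖iteratedFDeriv ℝ 2 φ x‖) (ENNReal.ofReal q) volume).toReal)) :
    (3 ≤ n → (n : ℝ) / ((n : ℝ) - 2) ≤ p →
      ∀ φ : EuclideanSpace ℝ (Fin n) → ℝ, ContDiff ℝ (⊤ : ℕ∞) φ → HasCompactSupport φ → ω φ = 0) ∧
    (2 ≤ n → (n : ℝ) / ((n : ℝ) - 1) ≤ p →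
      ∃ c₀ : ℝ, ∀ φ : EuclideanSpace ℝ (Fin n) → ℝ, ContDiff ℝ (⊤ : ℕ∞) φ →
        HasCompactSupport φ → ω φ = c₀ * φ 0) ∧
    ((n = 1 ∨ p < (n : ℝ) / ((n : ℝ) - 1)) →
      ∃ (c₀ : ℝ) (c : EuclideanSpace ℝ (Fin n)),
        ∀ φ : EuclideanSpace ℝ (Fin n) → ℝ, ContDiff ℝ (⊤ : ℕ∞) φ → HasCompactSupport φ →
          ω φ = c₀ * φ 0 + ⟪c, gradient φ 0⟫) := by
  have hn0 : (0 : ℝ) < n := by exact_mod_cast hn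
  have hq0 : 0 < q := by linarith
  have hd : (Module.finrank ℝ (EuclideanSpace ℝ (Fin n)) : ℝ) / q = n - n / p := by
    have h : 1 / q = 1 - 1 / p := by linarith
    rw [finrank_euclideanSpace_fin, div_eq_mul_one_div, h]
    ring
  let B : (k : ℕ) →
      (ContinuousMultilinearMap ℝ (fun _ : Fin k => EuclideanSpace ℝ (Fin n)) ℝ) →L[ℝ] ℝ :=
    fun k => if k < N + 1 then A k else 0
  have hωB : ∀ φ : EuclideanSpace ℝ (Fin n) → ℝ,
      ω φ = ∑ k ∈ Finset.range (N + 1 + 2), B k (iteratedFDeriv ℝ k φ 0) := by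
    intro φ
    rw [hω, Finset.sum_range_succ _ (N + 1 + 1), Finset.sum_range_succ _ (N + 1)]
    simp only [B, lt_irrefl, if_false, show ¬ N + 1 + 1 < N + 1 by omega,
      zero_apply, add_zero]
    refine Finset.sum_congr rfl fun k hk => ?_
    rw [if_pos (Finset.mem_range.1 hk)]
  have hbound' : ∀ φ : EuclideanSpace ℝ (Fin n) → ℝ, ContDiff ℝ (⊤ : ℕ∞) φ →
      HasCompactSupport φ →
      |∑ k ∈ Finset.range (N + 1 + 2), B k (iteratedFDeriv ℝ k φ 0)| ≤
        C * ∑ i ∈ Finset.range 3,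
          (eLpNorm (iteratedFDeriv ℝ i φ) (ENNReal.ofReal q) volume).toReal := by
    intro φ hφ hc
    have h0 : eLpNorm (iteratedFDeriv ℝ 0 φ) (ENNReal.ofReal q) volume =
        eLpNorm φ (ENNReal.ofReal q) volume :=
      eLpNorm_congr_norm_ae (.of_forall fun x => norm_iteratedFDeriv_zero)
    have h1 : eLpNorm (iteratedFDeriv ℝ 1 φ) (ENNReal.ofReal q) volume =
        eLpNorm (fderiv ℝ φ) (ENNReal.ofReal q) volume :=
      eLpNorm_congr_norm_ae (.of_forall fun x => norm_iteratedFDeriv_one φ)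
    have h := hbound φ hφ hc
    rw [eLpNorm_norm, eLpNorm_norm] at h
    rwa [← hωB, Finset.sum_range_succ, Finset.sum_range_succ, Finset.sum_range_one, h0, h1]
  have hvanish : ∀ k : ℕ, 2 - ((n : ℝ) - n / p) ≤ k →
      ∀ φ : EuclideanSpace ℝ (Fin n) → ℝ, ContDiff ℝ (⊤ : ℕ∞) φ → HasCompactSupport φ →
        k < N + 1 + 2 → B k (iteratedFDeriv ℝ k φ 0) = 0 := by
    intro k hk φ hφ hc hkN
    refine apply_iteratedFDeriv_eq_zero (μ := volume) ?_ hq hC hbound' hkN ?_ hφ hc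
    · rw [finrank_euclideanSpace_fin]
      exact hn
    · rwa [hd]
  have hnp : (n : ℝ) / p < n := div_lt_self hn0 hp
  have hω2 : ∀ φ : EuclideanSpace ℝ (Fin n) → ℝ, ContDiff ℝ (⊤ : ℕ∞) φ → HasCompactSupport φ →
      ω φ = B 0 (iteratedFDeriv ℝ 0 φ 0) + B 1 (iteratedFDeriv ℝ 1 φ 0) := by
    intro φ hφ hc
    rw [hωB, Finset.sum_range_succ', Finset.sum_range_succ', Finset.sum_eq_zero]
    · ring
    · intro k hk
      refine hvanish (k + 1 + 1) ?_ φ hφ hc (by have := Finset.mem_range.1 hk; omega)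
      push_cast
      have : (0 : ℝ) ≤ k := Nat.cast_nonneg k
      linarith
  obtain ⟨c₀, hc₀⟩ : ∃ c₀ : ℝ, ∀ φ : EuclideanSpace ℝ (Fin n) → ℝ,
      B 0 (iteratedFDeriv ℝ 0 φ 0) = c₀ * φ 0 := by
    refine ⟨B 0 (iteratedFDeriv ℝ 0 (fun _ => 1) 0), fun φ => ?_⟩
    have : iteratedFDeriv ℝ 0 φ 0 =
        φ 0 • iteratedFDeriv ℝ 0 (fun _ : EuclideanSpace ℝ (Fin n) => (1 : ℝ)) 0 := by
      ext v
      simp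
    rw [this, map_smul, smul_eq_mul, mul_comm]
  obtain ⟨c, hc₁⟩ := exists_apply_iteratedFDeriv_one_eq_inner_gradient (B 1)
  have hp0 : 0 < p := by linarith
  refine ⟨fun hn3 hpn φ hφ hc => ?_, fun hn2 hpn => ⟨c₀, fun φ hφ hc => ?_⟩,
    fun _ => ⟨c₀, c, fun φ hφ hc => ?_⟩⟩
  · have hn3' : (3 : ℝ) ≤ n := by exact_mod_cast hn3
    have hle : (n : ℝ) / p ≤ n - 2 := by
      rw [div_le_iff₀ (by linarith)] at hpn
      rw [div_le_iff₀ hp0]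
      linarith
    rw [hω2 φ hφ hc, hvanish 0 (by push_cast; linarith) φ hφ hc (by omega),
      hvanish 1 (by push_cast; linarith) φ hφ hc (by omega), add_zero]
  · have hn2' : (2 : ℝ) ≤ n := by exact_mod_cast hn2
    have hle : (n : ℝ) / p ≤ n - 1 := by
      rw [div_le_iff₀ (by linarith)] at hpn
      rw [div_le_iff₀ hp0]
      linarith
    rw [hω2 φ hφ hc, hvanish 1 (by push_cast; linarith) φ hφ hc (by omega), add_zero, hc₀]
  · rw [hω2 φ hφ hc, hc₀, hc₁]
end

section
/- For every x ∈ ℝ, ∫₀^∞ (4·π·t)^(−1/2)·exp(−x²/(4t) − t) dt = (1/2)·exp(−|x|). Moreover, for every x ∈ EuclideanSpace ℝ (Fin 3) with x ≠ 0, ∫₀^∞ (4·π·t)^(−3/2)·exp(−‖x‖²/(4t) − t) dt = exp(−‖x‖)/(4·π·‖x‖). -/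
open MeasureTheory Real

lemma image_sqrt_sub_div_sqrt_Ioi {a : ℝ} (ha : 0 < a) :
    (fun t : ℝ => √t - a / √t) '' Set.Ioi 0 = Set.univ := by
  refine Set.eq_univ_of_forall fun u => ?_
  have hd : |u| < √(u ^ 2 + 4 * a) := by
    rw [← sqrt_sq_eq_abs]
    exact sqrt_lt_sqrt (sq_nonneg u) (by linarith)
  have hq : √(u ^ 2 + 4 * a) ^ 2 = u ^ 2 + 4 * a := sq_sqrt (by positivity)
  have hs : 0 < (u + √(u ^ 2 + 4 * a)) / 2 := by linarith [neg_abs_le u]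
  refine ⟨((u + √(u ^ 2 + 4 * a)) / 2) ^ 2, pow_pos hs 2, ?_⟩
  simp only [sqrt_sq hs.le]
  rw [sub_eq_iff_eq_add, ← sub_eq_iff_eq_add', eq_div_iff hs.ne']
  linear_combination hq / 4

lemma injOn_sqrt_sub_div_sqrt_Ioi {a : ℝ} (ha : 0 < a) :
    Set.InjOn (fun t : ℝ => √t - a / √t) (Set.Ioi 0) := by
  refine StrictMonoOn.injOn fun s hs t _ hst => ?_
  have h : √s < √t := sqrt_lt_sqrt (le_of_lt hs) hst
  exact sub_lt_sub h (div_lt_div_of_pos_left ha (sqrt_pos.2 hs) h)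

lemma hasDerivAt_sqrt_sub_div_sqrt (a : ℝ) {t : ℝ} (ht : 0 < t) :
    HasDerivAt (fun t : ℝ => √t - a / √t) ((√t)⁻¹ / 2 + a / 2 * (t * √t)⁻¹) t := by
  have h := hasDerivAt_sqrt ht.ne'
  have hs := sqrt_pos.2 ht
  convert! h.sub ((hasDerivAt_const t a).div h hs.ne') using 1
  rw [sq_sqrt ht.le]
  field_simp
  ring

lemma exp_neg_sq_sqrt_sub_div_sqrt (a : ℝ) {t : ℝ} (ht : 0 < t) :
    exp (-(√t - a / √t) ^ 2) = exp (2 * a) * exp (-a ^ 2 / t - t) := by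
  have hs := sqrt_pos.2 ht
  rw [← exp_add]
  congr 1
  rw [sub_sq, div_pow, sq_sqrt ht.le]
  field_simp
  ring

lemma integrableOn_exp_neg_sq_div_sub {a : ℝ} (ha : 0 < a) :
    IntegrableOn (fun t : ℝ => ((√t)⁻¹ / 2 + a / 2 * (t * √t)⁻¹) * exp (-a ^ 2 / t - t))
      (Set.Ioi 0) := by
  have h := (integrableOn_image_iff_integrableOn_abs_deriv_smul measurableSet_Ioi
    (fun t ht => (hasDerivAt_sqrt_sub_div_sqrt a ht).hasDerivWithinAt)
    (injOn_sqrt_sub_div_sqrt_Ioi ha) (fun u => exp (-u ^ 2))).1 (by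
      rw [image_sqrt_sub_div_sqrt_Ioi ha, integrableOn_univ]
      simpa using integrable_exp_neg_mul_sq one_pos)
  refine IntegrableOn.congr_fun (h.const_mul (exp (-(2 * a)))) (fun t ht => ?_) measurableSet_Ioi
  have ht' : 0 < t := ht
  simp only [smul_eq_mul]
  rw [abs_of_pos (by positivity), exp_neg_sq_sqrt_sub_div_sqrt a ht', exp_neg]
  field_simp

lemma integral_exp_neg_sq_div_sub {a : ℝ} (ha : 0 < a) :
    ∫ t in Set.Ioi (0 : ℝ), ((√t)⁻¹ / 2 + a / 2 * (t * √t)⁻¹) * exp (-a ^ 2 / t - t)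
      = √π * exp (-(2 * a)) := by
  have h := integral_image_eq_integral_abs_deriv_smul measurableSet_Ioi
    (fun t ht => (hasDerivAt_sqrt_sub_div_sqrt a ht).hasDerivWithinAt)
    (injOn_sqrt_sub_div_sqrt_Ioi ha) (fun u => exp (-u ^ 2))
  have hg := integral_gaussian 1
  simp only [neg_mul, one_mul, div_one] at hg
  rw [image_sqrt_sub_div_sqrt_Ioi ha, setIntegral_univ, hg] at h
  rw [h, ← integral_mul_const]
  refine setIntegral_congr_fun measurableSet_Ioi fun t ht => ?_
  have ht' : 0 < t := ht
  simp only [smul_eq_mul]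
  rw [abs_of_pos (by positivity), exp_neg_sq_sqrt_sub_div_sqrt a ht', exp_neg]
  field_simp

lemma integral_inv_sqrt_mul_exp_eq_mul {a : ℝ} (ha : 0 < a) :
    ∫ t in Set.Ioi (0 : ℝ), (√t)⁻¹ * exp (-a ^ 2 / t - t)
      = a * ∫ t in Set.Ioi (0 : ℝ), (t * √t)⁻¹ * exp (-a ^ 2 / t - t) := by
  have himg : (fun t : ℝ => a ^ 2 / t) '' Set.Ioi 0 = Set.Ioi 0 := by
    ext s
    refine ⟨?_, fun hs => ⟨a ^ 2 / s, div_pos (pow_pos ha 2) hs, ?_⟩⟩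
    · rintro ⟨t, ht, rfl⟩
      exact div_pos (pow_pos ha 2) ht
    · have hs' : s ≠ 0 := ne_of_gt hs
      field_simp
  have hinj : Set.InjOn (fun t : ℝ => a ^ 2 / t) (Set.Ioi 0) :=
    fun s _ t _ hst => by
    simpa [div_eq_mul_inv, ha.ne'] using hst
  have hderiv : ∀ t ∈ Set.Ioi (0 : ℝ), HasDerivWithinAt (fun t : ℝ => a ^ 2 / t)
      (-(a ^ 2 / t ^ 2)) (Set.Ioi 0) t := fun t ht => by
    have ht' : t ≠ 0 := ne_of_gt ht
    convert! ((hasDerivAt_inv ht').const_mul (a ^ 2)).hasDerivWithinAt using 1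
    ring
  have h := integral_image_eq_integral_abs_deriv_smul measurableSet_Ioi hderiv hinj
    (fun t => (√t)⁻¹ * exp (-a ^ 2 / t - t))
  rw [himg] at h
  rw [h, ← integral_const_mul]
  refine setIntegral_congr_fun measurableSet_Ioi fun t ht => ?_
  have ht' : 0 < t := ht
  have hs := sqrt_pos.2 ht'
  have he : -a ^ 2 / (a ^ 2 / t) - a ^ 2 / t = -a ^ 2 / t - t := by
    field_simp
    ring
  simp only [smul_eq_mul]
  rw [he, abs_neg, abs_of_pos (by positivity), sqrt_div (sq_nonneg a), sqrt_sq ha.le]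
  field_simp
  rw [sq_sqrt ht'.le]

lemma integral_inv_mul_sqrt_mul_exp {a : ℝ} (ha : 0 < a) :
    ∫ t in Set.Ioi (0 : ℝ), (t * √t)⁻¹ * exp (-a ^ 2 / t - t) = √π * exp (-(2 * a)) / a := by
  have hint := integrableOn_exp_neg_sq_div_sub ha
  have h1 : IntegrableOn (fun t : ℝ => (√t)⁻¹ / 2 * exp (-a ^ 2 / t - t)) (Set.Ioi 0) := by
    refine Integrable.mono' hint (by fun_prop) ?_
    filter_upwards [ae_restrict_mem measurableSet_Ioi] with t ht
    have ht' : 0 < t := ht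
    rw [norm_of_nonneg (by positivity)]
    gcongr
    exact le_add_of_nonneg_right (by positivity)
  have h2 : IntegrableOn (fun t : ℝ => a / 2 * (t * √t)⁻¹ * exp (-a ^ 2 / t - t))
      (Set.Ioi 0) := by
    refine Integrable.mono' hint (by fun_prop) ?_
    filter_upwards [ae_restrict_mem measurableSet_Ioi] with t ht
    have ht' : 0 < t := ht
    rw [norm_of_nonneg (by positivity)]
    gcongr
    exact le_add_of_nonneg_left (by positivity)
  have h := integral_exp_neg_sq_div_sub ha
  simp only [add_mul] at h
  rw [integral_add h1 h2] at h
  simp only [div_eq_inv_mul _ (2 : ℝ), mul_assoc, integral_const_mul] at h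
  rw [integral_inv_sqrt_mul_exp_eq_mul ha] at h
  rw [eq_div_iff ha.ne', ← h]
  ring

lemma integral_inv_sqrt_mul_exp {a : ℝ} (ha : 0 ≤ a) :
    ∫ t in Set.Ioi (0 : ℝ), (√t)⁻¹ * exp (-a ^ 2 / t - t) = √π * exp (-(2 * a)) := by
  rcases ha.eq_or_lt with rfl | ha
  · have h := Real.Gamma_eq_integral (s := 1 / 2) (by norm_num)
    rw [Gamma_one_half_eq] at h
    simp only [mul_zero, neg_zero, exp_zero, mul_one]
    rw [h]
    refine setIntegral_congr_fun measurableSet_Ioi fun t ht => ?_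
    have ht' : 0 < t := ht
    rw [show (1 / 2 - 1 : ℝ) = -(1 / 2) by norm_num, rpow_neg ht'.le, ← sqrt_eq_rpow]
    simp [mul_comm]
  · rw [integral_inv_sqrt_mul_exp_eq_mul ha, integral_inv_mul_sqrt_mul_exp ha]
    field_simp

/-- Lemma 3.11 (L3.4): the explicit formulas `G₁(x) = ½e^{−|x|}` and
`G₃(x) = e^{−‖x‖}/(4π‖x‖)` for the Bessel potentials in dimensions 1 and 3. -/
theorem stmt4 :
    (∀ x : ℝ,
      (∫ t in Set.Ioi (0 : ℝ), (4 * Real.pi * t) ^ (-(1 : ℝ) / 2) *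
          Real.exp (-(x ^ 2) / (4 * t) - t))
        = (1 / 2) * Real.exp (-|x|)) ∧
    (∀ x : EuclideanSpace ℝ (Fin 3), x ≠ 0 →
      (∫ t in Set.Ioi (0 : ℝ), (4 * Real.pi * t) ^ (-(3 : ℝ) / 2) *
          Real.exp (-(‖x‖ ^ 2) / (4 * t) - t))
        = Real.exp (-‖x‖) / (4 * Real.pi * ‖x‖)) := by
  refine ⟨fun x => ?_, fun x hx => ?_⟩
  · have h := integral_inv_sqrt_mul_exp (a := |x| / 2) (by positivity)
    rw [show -|x| = -(2 * (|x| / 2)) by ring]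
    have hc : (1 / 2 : ℝ) * exp (-(2 * (|x| / 2)))
        = (√(4 * π))⁻¹ * (√π * exp (-(2 * (|x| / 2)))) := by
      rw [sqrt_mul (by norm_num), show (4 : ℝ) = 2 ^ 2 by norm_num, sqrt_sq (by norm_num)]
      have := sqrt_pos.2 pi_pos
      field_simp
    rw [hc, ← h, ← integral_const_mul]
    refine setIntegral_congr_fun measurableSet_Ioi fun t ht => ?_
    have ht' : 0 < t := ht
    rw [show (-(1 : ℝ) / 2) = -(1 / 2) by norm_num, rpow_neg (by positivity), ← sqrt_eq_rpow,
      sqrt_mul (by positivity), mul_inv, mul_assoc, div_pow, sq_abs]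
    congr 3
    field_simp
    ring
  · have hr : 0 < ‖x‖ := norm_pos_iff.2 hx
    have h := integral_inv_mul_sqrt_mul_exp (a := ‖x‖ / 2) (by positivity)
    rw [show -‖x‖ = -(2 * (‖x‖ / 2)) by ring]
    have hc : exp (-(2 * (‖x‖ / 2))) / (4 * π * ‖x‖)
        = (4 * π * √(4 * π))⁻¹ * (√π * exp (-(2 * (‖x‖ / 2))) / (‖x‖ / 2)) := by
      rw [sqrt_mul (by norm_num), show √(4 : ℝ) = 2 by
        rw [show (4 : ℝ) = 2 ^ 2 by norm_num, sqrt_sq (by norm_num)]]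
      have := sqrt_pos.2 pi_pos
      field_simp
    rw [hc, ← h, ← integral_const_mul]
    refine setIntegral_congr_fun measurableSet_Ioi fun t ht => ?_
    have ht' : 0 < t := ht
    have hp : (4 * π * t) ^ (-(3 : ℝ) / 2) = (4 * π * √(4 * π))⁻¹ * (t * √t)⁻¹ := by
      rw [show (-(3 : ℝ) / 2) = -(1 + 1 / 2) by norm_num, rpow_neg (by positivity),
        rpow_add (by positivity), rpow_one, ← sqrt_eq_rpow, sqrt_mul (by positivity), ← mul_inv]
      congr 1
      ring
    rw [hp, mul_assoc, div_pow]
    congr 3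
    field_simp
    ring
end

section
/- Let β ∈ ℝ with β < 0 or β > 4·π, set κ := 1 − 4·π/β and λ_β := κ², and define e : EuclideanSpace ℝ (Fin 3) ∖ {0} → ℝ by e(x) = exp(−κ·‖x‖)/(4·π·‖x‖). Then: (a) for every x ≠ 0, the pointwise Laplacian of e exists at x and ∑_{i=0}^{2} iteratedDeriv 2 (fun t : ℝ => e (x + t • e i)) 0 = λ_β · e(x); and (b) e(x) − exp(−‖x‖)/(4·π·‖x‖) tends to 1/β as x → 0 with x ≠ 0. -/
open MeasureTheory Real Topology Filter

section Yukawa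

variable {E : Type*} [NormedAddCommGroup E] [InnerProductSpace ℝ E]

theorem hasDerivAt_norm_add_smul (x u : E) (hu : ‖u‖ = 1) (s : ℝ) (hs : x + s • u ≠ 0) :
    HasDerivAt (fun s : ℝ => ‖x + s • u‖) ((inner ℝ x u + s) / ‖x + s • u‖) s := by
  have hline : HasDerivAt (fun s : ℝ => x + s • u) u s := by
    simpa using ((hasDerivAt_id s).smul_const u).const_add x
  have hsq := hline.norm_sq.sqrt (pow_ne_zero 2 (norm_ne_zero_iff.2 hs))
  simp only [Real.sqrt_sq (norm_nonneg _)] at hsq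
  convert hsq using 1
  rw [inner_add_left, real_inner_smul_left, real_inner_self_eq_norm_sq, hu]
  rw [one_pow, mul_one, mul_div_mul_left _ _ two_ne_zero]

theorem hasDerivAt_yukawa (κ r : ℝ) (hr : r ≠ 0) :
    HasDerivAt (fun r : ℝ => Real.exp (-(κ * r)) / (4 * Real.pi * r))
      (-((κ * r + 1) * Real.exp (-(κ * r)) / (4 * Real.pi * r ^ 2))) r := by
  have hexp : HasDerivAt (fun r : ℝ => Real.exp (-(κ * r)))
      (Real.exp (-(κ * r)) * -(κ * 1)) r := ((hasDerivAt_id r).const_mul κ).neg.exp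
  have hden : HasDerivAt (fun r : ℝ => 4 * Real.pi * r) (4 * Real.pi * 1) r :=
    (hasDerivAt_id r).const_mul _
  have hpi := Real.pi_ne_zero
  refine (hexp.div hden (by positivity)).congr_deriv ?_
  field_simp
  ring

theorem hasDerivAt_yukawa_radial (κ r : ℝ) (hr : r ≠ 0) :
    HasDerivAt (fun r : ℝ => -((κ * r + 1) * Real.exp (-(κ * r)) / (4 * Real.pi * r ^ 3)))
      ((κ ^ 2 * r ^ 2 + 3 * (κ * r + 1)) * Real.exp (-(κ * r)) / (4 * Real.pi * r ^ 4)) r := by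
  have hexp : HasDerivAt (fun r : ℝ => Real.exp (-(κ * r)))
      (Real.exp (-(κ * r)) * -(κ * 1)) r := ((hasDerivAt_id r).const_mul κ).neg.exp
  have hlin : HasDerivAt (fun r : ℝ => κ * r + 1) (κ * 1) r :=
    ((hasDerivAt_id r).const_mul κ).add_const 1
  have hden : HasDerivAt (fun r : ℝ => 4 * Real.pi * r ^ 3)
      (4 * Real.pi * ((3 : ℕ) * r ^ 2)) r := (hasDerivAt_pow 3 r).const_mul _
  have hpi := Real.pi_ne_zero
  refine ((hlin.mul hexp).div hden (by positivity)).neg.congr_deriv ?_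
  simp only [Pi.mul_apply]
  push_cast
  field_simp
  ring

theorem hasDerivAt_yukawa_line (κ : ℝ) (x u : E) (hu : ‖u‖ = 1) (s : ℝ) (hs : x + s • u ≠ 0) :
    HasDerivAt (fun s : ℝ => Real.exp (-(κ * ‖x + s • u‖)) / (4 * Real.pi * ‖x + s • u‖))
      (-((κ * ‖x + s • u‖ + 1) * Real.exp (-(κ * ‖x + s • u‖)) /
        (4 * Real.pi * ‖x + s • u‖ ^ 3)) * (inner ℝ x u + s)) s := by
  have hr := norm_ne_zero_iff.2 hs
  have hpi := Real.pi_ne_zero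
  refine ((hasDerivAt_yukawa κ _ hr).comp s (hasDerivAt_norm_add_smul x u hu s hs)).congr_deriv ?_
  field_simp

theorem eventually_add_smul_ne_zero {x : E} (hx : x ≠ 0) (u : E) :
    ∀ᶠ s in 𝓝 (0 : ℝ), x + s • u ≠ 0 := by
  have hc : ContinuousAt (fun s : ℝ => x + s • u) 0 := by fun_prop
  exact hc.eventually_ne (by simpa using hx)

theorem hasDerivAt_deriv_yukawa_line (κ : ℝ) {x : E} (hx : x ≠ 0) (u : E) (hu : ‖u‖ = 1) :
    HasDerivAt (deriv fun s : ℝ =>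
        Real.exp (-(κ * ‖x + s • u‖)) / (4 * Real.pi * ‖x + s • u‖))
      ((κ ^ 2 * ‖x‖ ^ 2 + 3 * (κ * ‖x‖ + 1)) * Real.exp (-(κ * ‖x‖)) /
          (4 * Real.pi * ‖x‖ ^ 5) * inner ℝ x u ^ 2 -
        (κ * ‖x‖ + 1) * Real.exp (-(κ * ‖x‖)) / (4 * Real.pi * ‖x‖ ^ 3)) 0 := by
  have hr := norm_ne_zero_iff.2 hx
  have hx0 : x + (0 : ℝ) • u ≠ 0 := by simpa using hx
  have hpi := Real.pi_ne_zero
  have hradial := (hasDerivAt_yukawa_radial κ _ (norm_ne_zero_iff.2 hx0)).comp 0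
    (hasDerivAt_norm_add_smul x u hu 0 hx0)
  have hprod := hradial.mul ((hasDerivAt_id (0 : ℝ)).const_add (inner ℝ x u))
  refine HasDerivAt.congr_of_eventuallyEq ?_
    ((eventually_add_smul_ne_zero hx u).mono fun s hs =>
      (hasDerivAt_yukawa_line κ x u hu s hs).deriv)
  refine hprod.congr_deriv ?_
  simp only [zero_smul, add_zero, Function.comp_apply, id, mul_one]
  field_simp
  ring

end Yukawa

theorem tendsto_yukawa_sub_yukawa {E : Type*} [NormedAddCommGroup E] (κ μ : ℝ) :
    Tendsto (fun x : E => Real.exp (-(κ * ‖x‖)) / (4 * Real.pi * ‖x‖) -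
        Real.exp (-(μ * ‖x‖)) / (4 * Real.pi * ‖x‖))
      (𝓝[≠] (0 : E)) (𝓝 ((μ - κ) / (4 * Real.pi))) := by
  have hexp (c : ℝ) : HasDerivAt (fun r : ℝ => Real.exp (-(c * r))) (-c) 0 := by
    simpa using ((hasDerivAt_id (0 : ℝ)).const_mul c).neg.exp
  have hslope := (hasDerivAt_iff_tendsto_slope.1 ((hexp κ).sub (hexp μ))).div_const (4 * Real.pi)
  have hnorm : Tendsto (fun x : E => ‖x‖) (𝓝[≠] (0 : E)) (𝓝[≠] (0 : ℝ)) :=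
    tendsto_norm_nhdsNE_zero.mono_right (nhdsWithin_mono _ fun _ h => ne_of_gt h)
  convert hslope.comp hnorm using 1
  · ext x
    simp only [Function.comp_apply, slope_def_field, Pi.sub_apply, mul_zero, neg_zero,
      Real.exp_zero, sub_self, sub_zero]
    rw [← sub_div, div_div, mul_comm ‖x‖]
  · congr 2
    ring

/-- Theorem 8.5(i) for `n = 3`: with `κ = 1 − 4π/β`, `λ_β = κ²`, the function
`e(x) = e^{−κ‖x‖}/(4π‖x‖)` satisfies `Δe = λ_β · e` pointwise on `ℝ³∖{0}`, and
`e(x) − G₃(x) → 1/β` as `x → 0` (the boundary condition `τ_β e = 0`). -/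
theorem stmt14 (β : ℝ) (hβ : β < 0 ∨ 4 * Real.pi < β) :
    let κ : ℝ := 1 - 4 * Real.pi / β
    let lamβ : ℝ := κ ^ 2
    let e : EuclideanSpace ℝ (Fin 3) → ℝ :=
      fun x => Real.exp (-(κ * ‖x‖)) / (4 * Real.pi * ‖x‖)
    (∀ x : EuclideanSpace ℝ (Fin 3), x ≠ 0 →
      (∀ i : Fin 3,
        (∀ᶠ t in 𝓝 (0 : ℝ), DifferentiableAt ℝ
          (fun s : ℝ => e (x + s • EuclideanSpace.single i (1 : ℝ))) t) ∧
        DifferentiableAt ℝ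
          (deriv fun s : ℝ => e (x + s • EuclideanSpace.single i (1 : ℝ))) 0) ∧
      ∑ i : Fin 3,
          iteratedDeriv 2 (fun t : ℝ => e (x + t • EuclideanSpace.single i (1 : ℝ))) 0
        = lamβ * e x) ∧
    Tendsto (fun x : EuclideanSpace ℝ (Fin 3) =>
        e x - Real.exp (-‖x‖) / (4 * Real.pi * ‖x‖))
      (𝓝[≠] (0 : EuclideanSpace ℝ (Fin 3))) (𝓝 (1 / β)) := by
  intro κ lamβ e
  refine ⟨fun x hx => ?_, ?_⟩
  · have hu (i : Fin 3) : ‖EuclideanSpace.single i (1 : ℝ)‖ = 1 := by simp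
    refine ⟨fun i => ⟨?_, (hasDerivAt_deriv_yukawa_line κ hx _ (hu i)).differentiableAt⟩, ?_⟩
    · exact (eventually_add_smul_ne_zero hx _).mono fun s hs =>
        (hasDerivAt_yukawa_line κ x _ (hu i) s hs).differentiableAt
    · have hsecond (i : Fin 3) := (hasDerivAt_deriv_yukawa_line κ hx _ (hu i)).deriv
      have hsum : ∑ i : Fin 3, inner ℝ x (EuclideanSpace.single i (1 : ℝ)) ^ 2 = ‖x‖ ^ 2 := by
        simp [EuclideanSpace.inner_single_right, EuclideanSpace.norm_sq_eq]
      simp only [e, lamβ, iteratedDeriv_succ, iteratedDeriv_zero, hsecond]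
      rw [Finset.sum_sub_distrib, ← Finset.mul_sum, hsum]
      simp only [Finset.sum_const, Finset.card_univ, Fintype.card_fin, nsmul_eq_mul]
      have hr := norm_ne_zero_iff.2 hx
      have hpi := Real.pi_ne_zero
      push_cast
      field_simp
      ring
  · have hβ0 : β ≠ 0 := by
      rcases hβ with h | h
      · exact h.ne
      · exact (lt_trans (by positivity) h).ne'
    have hpi := Real.pi_ne_zero
    have hlim : (1 - κ) / (4 * Real.pi) = 1 / β := by
      simp only [κ]
      field_simp
      ring
    have h := tendsto_yukawa_sub_yukawa (E := EuclideanSpace ℝ (Fin 3)) κ 1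
    simpa only [one_mul, hlim] using h
end

section
/- Let X be a real Banach space and A : X →ₗ.[ℝ] X a linear partial map (unbounded operator) with dense domain and closed graph, and assume A has a resolvent point. Let D₀ be a submodule of the domain of A and let A₀ be the restriction of A to D₀. Assume D₀ is a core of A, i.e., the topological closure of the graph of A₀ equals the graph of A. If B : X →ₗ.[ℝ] X is any linear partial map with A₀ ≤ B such that some λ ∈ ℝ is a resolvent point of both A and B, then B = A. -/
open MeasureTheory Topology

/-- `lam` is a resolvent point of the unbounded operator `T` if `lam • id − T` has a
bounded everywhere-defined two-sided inverse. -/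
def IsResolventPoint {X : Type*} [NormedAddCommGroup X] [NormedSpace ℝ X]
    (T : X →ₗ.[ℝ] X) (lam : ℝ) : Prop :=
  ∃ R : X →L[ℝ] X,
    (∀ y : X, ∃ hy : R y ∈ T.domain, lam • R y - T ⟨R y, hy⟩ = y) ∧
    (∀ x : T.domain, R (lam • (x : X) - T x) = (x : X))

namespace LinearPMap

variable {X : Type*} [NormedAddCommGroup X] [NormedSpace ℝ X]

theorem mem_graph_iff_resolvent_apply_eq {T : X →ₗ.[ℝ] X} {lam : ℝ} {R : X →L[ℝ] X}
    (hright : ∀ y : X, ∃ hy : R y ∈ T.domain, lam • R y - T ⟨R y, hy⟩ = y)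
    (hleft : ∀ x : T.domain, R (lam • (x : X) - T x) = (x : X)) (p : X × X) :
    p ∈ T.graph ↔ R (lam • p.1 - p.2) = p.1 := by
  obtain ⟨x, y⟩ := p
  constructor
  · intro hp
    obtain ⟨u, rfl, rfl⟩ := (mem_graph_iff T).1 hp
    exact hleft u
  · intro hR
    obtain ⟨hy, h⟩ := hright (lam • x - y)
    refine (mem_graph_iff T).2 ⟨⟨_, hy⟩, hR, ?_⟩
    simpa [hR] using h

theorem isClosed_graph_of_isResolventPoint {T : X →ₗ.[ℝ] X} {lam : ℝ}
    (h : IsResolventPoint T lam) : _root_.IsClosed (T.graph : Set (X × X)) := by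
  obtain ⟨R, hright, hleft⟩ := h
  have hset : (T.graph : Set (X × X)) = {p | R (lam • p.1 - p.2) = p.1} :=
    Set.ext (mem_graph_iff_resolvent_apply_eq hright hleft)
  rw [hset]
  exact isClosed_eq (by fun_prop) continuous_fst

theorem eq_of_le_of_isResolventPoint {T S : X →ₗ.[ℝ] X} {lam : ℝ} (hle : T ≤ S)
    (hT : IsResolventPoint T lam) (hS : IsResolventPoint S lam) : T = S := by
  refine eq_of_le_of_domain_eq hle (le_antisymm hle.1 fun x hx => ?_)
  obtain ⟨R, hR, -⟩ := hT
  obtain ⟨Q, -, hQ⟩ := hS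
  obtain ⟨hmem, h⟩ := hR (lam • x - S ⟨x, hx⟩)
  have hval := hle.2 (x := ⟨_, hmem⟩) (y := ⟨_, hle.1 hmem⟩) rfl
  have hQR := hQ ⟨_, hle.1 hmem⟩
  rw [← hval, h, hQ ⟨x, hx⟩] at hQR
  rwa [show x = _ from hQR]

end LinearPMap

/-- Theorem 5.1(i) (thm-Nagel): if `D₀` is a core of the closed densely defined operator
`A` (with nonempty resolvent set), then any extension `B` of `A₀ = A|_{D₀}` whose
resolvent set meets that of `A` equals `A`. -/
theorem stmt15 {X : Type*} [NormedAddCommGroup X] [NormedSpace ℝ X] [CompleteSpace X]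
    (A : X →ₗ.[ℝ] X)
    (hdense : Dense (A.domain : Set X))
    (hclosed : IsClosed (A.graph : Set (X × X)))
    (hres : ∃ μ : ℝ, IsResolventPoint A μ)
    (D₀ : Submodule ℝ X) (hD₀ : D₀ ≤ A.domain)
    (hcore : closure ((A.domRestrict D₀).graph : Set (X × X)) = (A.graph : Set (X × X)))
    (B : X →ₗ.[ℝ] X) (hAB : A.domRestrict D₀ ≤ B)
    (hresB : ∃ lam : ℝ, IsResolventPoint A lam ∧ IsResolventPoint B lam) :
    B = A := by
  obtain ⟨lam, hA, hB⟩ := hresB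
  refine (LinearPMap.eq_of_le_of_isResolventPoint (LinearPMap.le_of_le_graph ?_) hA hB).symm
  rw [← SetLike.coe_subset_coe, ← hcore]
  exact closure_minimal (LinearPMap.le_graph_of_le hAB)
    (LinearPMap.isClosed_graph_of_isResolventPoint hB)
end

section
/- Let X be a real Banach space and A : X →ₗ.[ℝ] X a linear partial map (unbounded operator) with dense domain and closed graph, and assume A has a resolvent point. Let D₀ be a submodule of the domain of A and let A₀ be the restriction of A to D₀. Assume D₀ is NOT a core of A, i.e., the topological closure of the graph of A₀ is strictly contained in the graph of A. Then the set of linear partial maps B : X →ₗ.[ℝ] X such that A₀ ≤ B and some λ ∈ ℝ is a resolvent point of both A and B is infinite. -/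
open MeasureTheory Topology

/-- Hahn-Banach: a subspace that is not dense is annihilated by a nonzero continuous functional. -/
theorem exists_strongDual_ne_zero_of_not_dense {X : Type*} [NormedAddCommGroup X]
    [NormedSpace ℝ X] (M : Submodule ℝ X) (hM : ¬ Dense (M : Set X)) :
    ∃ f : StrongDual ℝ X, f ≠ 0 ∧ ∀ m ∈ M, f m = 0 := by
  obtain ⟨y, hy⟩ : ∃ y, y ∉ closure (M : Set X) := by simpa [Dense] using hM
  rw [← Submodule.topologicalClosure_coe] at hy
  obtain ⟨f, u, hyu, hu⟩ := geometric_hahn_banach_point_closed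
    M.topologicalClosure.convex M.isClosed_topologicalClosure hy
  have hu0 : u < 0 := by simpa using hu 0 (zero_mem _)
  refine ⟨f, ?_, fun m hm => ?_⟩
  · rintro rfl
    exact (hyu.trans hu0).ne rfl
  · by_contra hne
    have h := hu _ (M.topologicalClosure.smul_mem (u / f m) (M.le_topologicalClosure hm))
    simp [hne] at h

namespace LinearPMap

variable {X : Type*} [NormedAddCommGroup X] [NormedSpace ℝ X]

/-- The linear map `lam • id - A` on the domain of `A`. -/
def smulIdSub (A : X →ₗ.[ℝ] X) (lam : ℝ) : A.domain →ₗ[ℝ] X :=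
  lam • A.domain.subtype - A.toFun

@[simp]
theorem smulIdSub_apply (A : X →ₗ.[ℝ] X) (lam : ℝ) (x : A.domain) :
    A.smulIdSub lam x = lam • (x : X) - A x :=
  rfl

/-- If `lam • id - A` maps a subspace `D` of the domain onto a dense subspace, where `lam` is a
resolvent point of `A`, then the graph of `A` lies in the closure of the graph of its restriction
to `D`. -/
theorem graph_subset_closure_graph_domRestrict {A : X →ₗ.[ℝ] X} {lam : ℝ}
    (hA : IsResolventPoint A lam) (D : Submodule ℝ X)
    (hD : Dense (((D.comap A.domain.subtype).map (A.smulIdSub lam) : Submodule ℝ X) : Set X)) :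
    (A.graph : Set (X × X)) ⊆ _root_.closure ((A.domRestrict D).graph : Set (X × X)) := by
  obtain ⟨R, -, hR⟩ := hA
  rintro ⟨x, z⟩ hxz
  obtain ⟨x, rfl, rfl⟩ := A.mem_graph_iff.mp hxz
  let φ : X → X × X := fun y => (R y, lam • R y - y)
  have hφ : Continuous φ := by fun_prop
  have hφx (x : A.domain) : φ (A.smulIdSub lam x) = ((x : X), A x) := by
    simp [φ, hR]
  rw [← hφx x]
  refine map_mem_closure hφ (hD _) ?_
  rintro _ ⟨d, hd, rfl⟩
  rw [hφx]
  exact (A.domRestrict D).mem_graph_iff.mpr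
    ⟨⟨d, hd, d.2⟩, rfl, domRestrict_apply rfl⟩

/-- The operator `x ↦ A x + f ((lam • id - A) x) • v` on the domain of `A`. -/
def rankOnePerturbation (A : X →ₗ.[ℝ] X) (lam : ℝ) (f : StrongDual ℝ X) (v : X) :
    X →ₗ.[ℝ] X :=
  ⟨A.domain, A.toFun + ((f : X →ₗ[ℝ] ℝ) ∘ₗ A.smulIdSub lam).smulRight v⟩

theorem rankOnePerturbation_apply (A : X →ₗ.[ℝ] X) (lam : ℝ) (f : StrongDual ℝ X) (v : X)
    (x : A.domain) :
    A.rankOnePerturbation lam f v x = A x + f (lam • (x : X) - A x) • v :=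
  rfl

theorem isResolventPoint_rankOnePerturbation {A : X →ₗ.[ℝ] X} {lam : ℝ}
    (hA : IsResolventPoint A lam) (f : StrongDual ℝ X) (v : X) (hfv : f v ≠ 1) :
    IsResolventPoint (A.rankOnePerturbation lam f v) lam := by
  obtain ⟨R, hR₁, hR₂⟩ := hA
  have hne : 1 - f v ≠ 0 := sub_ne_zero.mpr hfv.symm
  refine ⟨R ∘L (ContinuousLinearMap.id ℝ X + (1 - f v)⁻¹ • f.smulRight v), fun y => ?_,
    fun x => ?_⟩
  · obtain ⟨hy, h⟩ := hR₁ (y + (1 - f v)⁻¹ • f y • v)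
    refine ⟨hy, ?_⟩
    refine (congrArg (lam • R (y + (1 - f v)⁻¹ • f y • v) - ·)
      (A.rankOnePerturbation_apply lam f v ⟨_, hy⟩)).trans ?_
    rw [← sub_sub, h]
    simp only [_root_.map_add, _root_.map_smul, smul_eq_mul]
    match_scalars
    · ring
    · field_simp
      ring
  · rw [rankOnePerturbation_apply A lam f v x, ← sub_sub]
    refine Eq.trans (congrArg R ?_) (hR₂ x)
    generalize lam • (x : X) - A x = w
    change (w - f w • v) + (1 - f v)⁻¹ • f (w - f w • v) • v = w
    simp only [_root_.map_sub, _root_.map_smul, smul_eq_mul]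
    match_scalars
    · ring
    · field_simp
      ring

theorem domRestrict_le_rankOnePerturbation (A : X →ₗ.[ℝ] X) (lam : ℝ) (D : Submodule ℝ X)
    (f : StrongDual ℝ X) (v : X)
    (hf : ∀ x : A.domain, (x : X) ∈ D → f (lam • (x : X) - A x) = 0) :
    A.domRestrict D ≤ A.rankOnePerturbation lam f v := by
  refine ⟨inf_le_right, fun x y hxy => ?_⟩
  rw [rankOnePerturbation_apply A lam f v y, hf y (hxy ▸ x.2.1), zero_smul, add_zero]
  exact domRestrict_apply hxy

theorem rankOnePerturbation_injective {A : X →ₗ.[ℝ] X} {lam : ℝ}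
    (hA : IsResolventPoint A lam) {f : StrongDual ℝ X} (hf : f ≠ 0) :
    Function.Injective (A.rankOnePerturbation lam f) := by
  obtain ⟨R, hR, -⟩ := hA
  obtain ⟨w, hw⟩ := ContinuousLinearMap.exists_ne_zero hf
  obtain ⟨hd, h⟩ := hR w
  intro v v' hvv
  have key := (ext_iff.mp hvv).2 (x := R w) (hf := hd) (hg := hd)
  replace key := (A.rankOnePerturbation_apply lam f v ⟨_, hd⟩).symm.trans
    (key.trans (A.rankOnePerturbation_apply lam f v' ⟨_, hd⟩))
  rw [h] at key
  exact smul_right_injective X hw (add_left_cancel key)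

end LinearPMap

/-- Theorem 5.1(ii) (thm-Nagel): if `D₀` is NOT a core of the closed densely defined
operator `A` (with nonempty resolvent set), then there are infinitely many extensions
`B` of `A₀ = A|_{D₀}` whose resolvent set meets that of `A`. -/
theorem stmt16 {X : Type*} [NormedAddCommGroup X] [NormedSpace ℝ X] [CompleteSpace X]
    (A : X →ₗ.[ℝ] X)
    (hdense : Dense (A.domain : Set X))
    (hclosed : IsClosed (A.graph : Set (X × X)))
    (hres : ∃ μ : ℝ, IsResolventPoint A μ)
    (D₀ : Submodule ℝ X) (hD₀ : D₀ ≤ A.domain)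
    (hnotcore :
      closure ((A.domRestrict D₀).graph : Set (X × X)) ⊂ (A.graph : Set (X × X))) :
    {B : X →ₗ.[ℝ] X | A.domRestrict D₀ ≤ B ∧
      ∃ lam : ℝ, IsResolventPoint A lam ∧ IsResolventPoint B lam}.Infinite := by
  obtain ⟨μ, hμ⟩ := hres
  obtain ⟨f, hf, hfM⟩ := exists_strongDual_ne_zero_of_not_dense
    ((D₀.comap A.domain.subtype).map (A.smulIdSub μ))
    fun h => hnotcore.2 (LinearPMap.graph_subset_closure_graph_domRestrict hμ D₀ h)
  obtain ⟨w, hw⟩ := ContinuousLinearMap.exists_ne_zero hf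
  have hw0 : w ≠ 0 := by
    rintro rfl
    exact hw (map_zero f)
  have hinj : Function.Injective fun t : ℝ => A.rankOnePerturbation μ f (t • w) :=
    (LinearPMap.rankOnePerturbation_injective hμ hf).comp (smul_left_injective ℝ hw0)
  refine ((Set.finite_singleton (f w)⁻¹).infinite_compl.image hinj.injOn).mono ?_
  rintro _ ⟨t, ht, rfl⟩
  refine ⟨A.domRestrict_le_rankOnePerturbation μ D₀ f _
    fun x hx => hfM _ ⟨x, hx, rfl⟩, μ, hμ,
    LinearPMap.isResolventPoint_rankOnePerturbation hμ f _ fun h => ht ?_⟩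
  rw [map_smul, smul_eq_mul] at h
  exact eq_inv_of_mul_eq_one_left h
end

section
/- Let n ≥ 1 and m ≥ 1 be integers and p ∈ ℝ with 1 < p < ∞. The following are equivalent: (a) p ≤ n/m; (b) for every smooth compactly supported f : EuclideanSpace ℝ (Fin n) → ℝ and every ε > 0 there exists a smooth compactly supported g : EuclideanSpace ℝ (Fin n) → ℝ with 0 ∉ tsupport g such that ∑_{k=0}^{m} eLpNorm (fun x => ‖iteratedFDeriv ℝ k (f − g) x‖) p volume < ENNReal.ofReal ε. -/
open MeasureTheory Real Topology

open scoped ENNReal NNReal ContDiff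

section Calculus

variable {E F : Type*} [NormedAddCommGroup E] [NormedSpace ℝ E]
  [NormedAddCommGroup F] [NormedSpace ℝ F]

/-- Taylor's formula with integral remainder, for a function vanishing near `R`, as a bound. -/
lemma enorm_apply_zero_le_lintegral_iteratedDeriv [CompleteSpace F] {φ : ℝ → F}
    (hφ : ContDiff ℝ ∞ φ) {R : ℝ} (hR : 0 < R) (hφR : φ =ᶠ[𝓝 R] 0) (k : ℕ) :
    ‖φ 0‖ₑ ≤ ∫⁻ t in Set.Ioc 0 R, ENNReal.ofReal (t ^ k) * ‖iteratedDeriv (k + 1) φ t‖ₑ := by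
  have hU : UniqueDiffOn ℝ (Set.uIcc R 0) := uniqueDiffOn_uIcc hR.ne'
  have hW : ∀ j : ℕ, ∀ t ∈ Set.uIcc R 0,
      iteratedDerivWithin j φ (Set.uIcc R 0) t = iteratedDeriv j φ t := fun j t ht =>
    iteratedDerivWithin_eq_iteratedDeriv hU (hφ.contDiffAt.of_le (mod_cast le_top)) ht
  have hT := taylor_integral_remainder (f := φ) (x := 0) (x₀ := R) (n := k)
    (hφ.of_le (mod_cast le_top)).contDiffOn
  have h0 : taylorWithinEval φ k (Set.uIcc R 0) R 0 = 0 := by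
    rw [taylor_within_apply]
    refine Finset.sum_eq_zero fun j _ => ?_
    rw [hW j R Set.left_mem_uIcc, hφR.iteratedDeriv_eq j]
    simp
  rw [h0, sub_zero, intervalIntegral.integral_symm, intervalIntegral.integral_of_le hR.le] at hT
  rw [hT, enorm_neg]
  refine (enorm_integral_le_lintegral_enorm _).trans ?_
  refine lintegral_mono_ae ((ae_restrict_iff' measurableSet_Ioc).2 (.of_forall fun t ht => ?_))
  rw [enorm_smul, hW _ t (by rw [Set.uIcc_of_ge hR.le]; exact ⟨ht.1.le, ht.2⟩)]
  gcongr
  rw [Real.enorm_eq_ofReal_abs]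
  refine ENNReal.ofReal_le_ofReal ?_
  rw [abs_div, abs_pow, zero_sub, abs_neg, abs_of_pos ht.1, Nat.abs_cast]
  exact div_le_self (pow_nonneg ht.1.le _)
    (mod_cast Nat.one_le_iff_ne_zero.2 (Nat.factorial_ne_zero k))

lemma norm_iteratedDeriv_comp_smul_le {u : E → F} (hu : ContDiff ℝ ∞ u) (x : E) (m : ℕ) (t : ℝ) :
    ‖iteratedDeriv m (fun s : ℝ => u (s • x)) t‖ ≤ ‖iteratedFDeriv ℝ m u (t • x)‖ * ‖x‖ ^ m := by
  rw [← norm_iteratedFDeriv_eq_norm_iteratedDeriv]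
  have h := (ContinuousLinearMap.toSpanSingleton ℝ x).iteratedFDeriv_comp_right hu t (i := m)
    (mod_cast le_top)
  have h2 : (u ∘ (ContinuousLinearMap.toSpanSingleton ℝ x)) = fun s : ℝ => u (s • x) := by
    ext s; simp
  rw [h2] at h
  rw [h]
  refine (ContinuousMultilinearMap.norm_compContinuousLinearMap_le _ _).trans ?_
  simp

lemma norm_iteratedFDeriv_comp_const_smul {f : E → F} (hf : ContDiff ℝ ∞ f) (c : ℝ) (k : ℕ)
    (x : E) :
    ‖iteratedFDeriv ℝ k (fun y => f (c • y)) x‖ = |c| ^ k * ‖iteratedFDeriv ℝ k f (c • x)‖ := by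
  rw [iteratedFDeriv_comp_const_smul c (hf.of_le (mod_cast le_top))]
  simp [norm_smul]

lemma continuous_norm_iteratedFDeriv {f : E → F} (hf : ContDiff ℝ ∞ f) (k : ℕ) :
    Continuous fun x => ‖iteratedFDeriv ℝ k f x‖ :=
  (hf.continuous_iteratedFDeriv (mod_cast le_top)).norm

lemma ContDiffBump.norm_mem_Icc_of_iteratedFDeriv_ne_zero [FiniteDimensional ℝ E]
    (b : ContDiffBump (0 : E)) {k : ℕ} (hk : k ≠ 0) {x : E} (hx : iteratedFDeriv ℝ k b x ≠ 0) :
    ‖x‖ ∈ Set.Icc b.rIn b.rOut := by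
  constructor
  · by_contra! h
    refine hx ?_
    have h1 := (b.eventuallyEq_one_of_mem_ball (mem_ball_zero_iff.2 h)).iteratedFDeriv ℝ k
    rw [h1.eq_of_nhds, show (1 : E → ℝ) = fun _ => 1 from rfl, iteratedFDeriv_const_of_ne hk]
    rfl
  · have h := support_iteratedFDeriv_subset (𝕜 := ℝ) k hx
    rw [b.tsupport_eq] at h
    simpa using h

end Calculus

section Measure

variable {E : Type*} [NormedAddCommGroup E] [NormedSpace ℝ E] [MeasurableSpace E] [BorelSpace E]

/-- Multiplication by a fixed test function is bounded on `W^{m,p}`. -/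
lemma exists_eLpNorm_iteratedFDeriv_mul_le (μ : Measure E) {χ : E → ℝ} (hχ : ContDiff ℝ ∞ χ)
    (hχc : HasCompactSupport χ) (m : ℕ) {p : ℝ≥0∞} (hp : 1 ≤ p) :
    ∃ M : ℝ≥0, ∀ h : E → ℝ, ContDiff ℝ ∞ h → ∀ k ≤ m,
      eLpNorm (fun x => ‖iteratedFDeriv ℝ k (fun y => h y * χ y) x‖) p μ ≤
        M * ∑ i ∈ Finset.range (m + 1), eLpNorm (fun x => ‖iteratedFDeriv ℝ i h x‖) p μ := by
  have hb : ∀ k : ℕ, ∃ C, ∀ x, ‖iteratedFDeriv ℝ k χ x‖ ≤ C := fun k =>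
    (hχc.iteratedFDeriv k).exists_bound_of_continuous
      (hχ.continuous_iteratedFDeriv (mod_cast le_top))
  choose C hC using hb
  have hC0 : ∀ k, 0 ≤ C k := fun k => (norm_nonneg _).trans (hC k 0)
  set B : ℝ := ∑ j ∈ Finset.range (m + 1), C j
  have hCB : ∀ j ≤ m, C j ≤ B := fun j hj =>
    Finset.single_le_sum (fun i _ => hC0 i) (Finset.mem_range.2 (by omega))
  have hB : 0 ≤ B := (hC0 0).trans (hCB 0 (Nat.zero_le _))
  obtain ⟨M, hM⟩ : ∃ M : ℝ≥0, (M : ℝ) = 2 ^ m * B := CanLift.prf _ (by positivity)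
  refine ⟨M, fun h hh k hk => ?_⟩
  refine (eLpNorm_le_nnreal_smul_eLpNorm_of_ae_le_mul
    (g := ∑ i ∈ Finset.range (m + 1), fun x => ‖iteratedFDeriv ℝ i h x‖)
    (c := M) (.of_forall fun x => ?_) p).trans ?_
  · rw [← NNReal.coe_le_coe]
    rw [NNReal.coe_mul, coe_nnnorm, coe_nnnorm, norm_norm, Finset.sum_apply,
      Real.norm_of_nonneg (Finset.sum_nonneg fun i _ => norm_nonneg _), hM]
    refine (norm_iteratedFDeriv_mul_le hh hχ x (mod_cast le_top)).trans ?_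
    rw [Finset.mul_sum]
    refine (Finset.sum_le_sum fun i hi => ?_).trans
      (Finset.sum_le_sum_of_subset_of_nonneg (Finset.range_mono (by omega : k + 1 ≤ m + 1))
        fun i _ _ => by positivity)
    have h1 : ((k.choose i : ℕ) : ℝ) ≤ 2 ^ m :=
      (mod_cast Nat.choose_le_two_pow k i : ((k.choose i : ℕ) : ℝ) ≤ 2 ^ k).trans
        (pow_le_pow_right₀ one_le_two hk)
    have h2 := (hC (k - i) x).trans (hCB (k - i) (by omega))
    calc _ ≤ 2 ^ m * ‖iteratedFDeriv ℝ i h x‖ * B := by gcongr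
      _ = _ := by ring
  · rw [ENNReal.smul_def, smul_eq_mul]
    gcongr
    exact eLpNorm_sum_le
      (fun i _ => (continuous_norm_iteratedFDeriv hh i).aestronglyMeasurable) hp

variable [FiniteDimensional ℝ E] (μ : Measure E) [μ.IsAddHaarMeasure]

lemma eLpNorm_comp_const_smul {g : E → ℝ} (hg : Continuous g) {p : ℝ} (hp : 0 < p)
    {c : ℝ} (hc : 0 < c) :
    eLpNorm (fun x => g (c • x)) (ENNReal.ofReal p) μ =
      ENNReal.ofReal (c ^ (-(Module.finrank ℝ E / p : ℝ))) * eLpNorm g (ENNReal.ofReal p) μ := by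
  have h := eLpNorm_map_measure (μ := μ) (f := fun x : E => c • x) (p := ENNReal.ofReal p)
    hg.aestronglyMeasurable (by fun_prop)
  rw [Measure.map_addHaar_smul μ hc.ne',
    eLpNorm_smul_measure_of_ne_top ENNReal.ofReal_ne_top, smul_eq_mul] at h
  refine h.symm.trans ?_
  congr 1
  rw [one_div, ENNReal.toReal_inv, ENNReal.toReal_ofReal hp.le,
    ENNReal.ofReal_rpow_of_nonneg (abs_nonneg _) (by positivity), abs_of_nonneg (by positivity),
    ← Real.rpow_natCast, ← Real.rpow_neg hc.le, ← Real.rpow_mul hc.le]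
  congr 2
  ring

/-- The Sobolev embedding `W^{m,p} ⊆ C⁰` for `m p > n`, for functions with support in a fixed
ball. -/
lemma exists_enorm_apply_zero_le_eLpNorm [Nontrivial E] {m : ℕ} (hm : 1 ≤ m) {p : ℝ} (hp : 1 < p)
    (hmp : (Module.finrank ℝ E : ℝ) < m * p) {R : ℝ} (hR : 0 < R) :
    ∃ C : ℝ≥0∞, C ≠ ⊤ ∧ ∀ u : E → ℝ, ContDiff ℝ ∞ u → (∀ x, R ≤ ‖x‖ → u x = 0) →
      ‖u 0‖ₑ ≤ C * eLpNorm (fun x => ‖iteratedFDeriv ℝ m u x‖) (ENNReal.ofReal p) μ := by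
  obtain ⟨k, rfl⟩ : ∃ k, m = k + 1 := ⟨m - 1, by omega⟩
  obtain ⟨z, hz⟩ := exists_norm_eq E (zero_le_two (α := ℝ))
  set A := Metric.ball z 1
  have hp0 : 0 < p := by linarith
  have hA0 : μ A ≠ 0 := (Metric.measure_ball_pos μ z one_pos).ne'
  have hAt : μ A ≠ ⊤ := measure_ball_lt_top.ne
  have hA : ∀ x ∈ A, 1 ≤ ‖x‖ ∧ ‖x‖ ≤ 3 := fun x hx => by
    have h1 : ‖x - z‖ < 1 := by simpa [A, dist_eq_norm] using hx
    have h2 := norm_sub_norm_le x z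
    have h3 := norm_sub_norm_le z x
    rw [norm_sub_rev] at h3
    constructor <;> linarith
  set d : ℝ := Module.finrank ℝ E / p with hd
  have hdk : d < k + 1 := by
    rw [hd, div_lt_iff₀ hp0]; exact_mod_cast hmp
  set J : ℝ≥0∞ := ∫⁻ t in Set.Ioc 0 (R + 1), ENNReal.ofReal (t ^ k) * ENNReal.ofReal (t ^ (-d))
    with hJ
  have hJt : J ≠ ⊤ := by
    have hi : IntegrableOn (fun t : ℝ => t ^ ((k : ℝ) - d)) (Set.Ioc 0 (R + 1)) :=
      (intervalIntegrable_iff_integrableOn_Ioc_of_le (by positivity)).1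
        (intervalIntegral.intervalIntegrable_rpow' (by linarith))
    refine ne_of_eq_of_ne (setLIntegral_congr_fun measurableSet_Ioc fun t ht => ?_)
      hi.lintegral_lt_top.ne
    rw [← ENNReal.ofReal_mul (pow_nonneg ht.1.le _), ← Real.rpow_natCast, ← Real.rpow_add ht.1,
      sub_eq_add_neg]
  set S : ℝ≥0∞ := μ A ^ (1 - 1 / p)
  have hSt : S ≠ ⊤ := ENNReal.rpow_ne_top_of_nonneg
    (sub_nonneg.2 ((div_le_one hp0).2 hp.le)) hAt
  refine ⟨(μ A)⁻¹ * (J * (3 ^ (k + 1) * S)), ?_, fun u hu huR => ?_⟩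
  · exact ENNReal.mul_ne_top (ENNReal.inv_ne_top.2 hA0) (ENNReal.mul_ne_top hJt
      (ENNReal.mul_ne_top (by finiteness) hSt))
  set G : E → ℝ := fun x => ‖iteratedFDeriv ℝ (k + 1) u x‖ with hG
  have hGc : Continuous G := continuous_norm_iteratedFDeriv hu (k + 1)
  set N := eLpNorm G (ENNReal.ofReal p) μ
  have hray : ∀ x ∈ A, ‖u 0‖ₑ ≤ ∫⁻ t in Set.Ioc 0 (R + 1),
      ENNReal.ofReal (t ^ k) * (3 ^ (k + 1) * ‖G (t • x)‖ₑ) := by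
    intro x hx
    have h := enorm_apply_zero_le_lintegral_iteratedDeriv (φ := fun s : ℝ => u (s • x))
      (hu.comp (by fun_prop)) (R := R + 1) (by positivity) ?_ k
    · simp only [zero_smul] at h
      refine h.trans (lintegral_mono fun t => ?_)
      gcongr
      have h1 : ‖iteratedDeriv (k + 1) (fun s : ℝ => u (s • x)) t‖ ≤ 3 ^ (k + 1) * G (t • x) := by
        refine (norm_iteratedDeriv_comp_smul_le hu x (k + 1) t).trans ?_
        rw [mul_comm]
        gcongr
        exact (hA x hx).2
      rw [← ofReal_norm, ← ofReal_norm, show ‖G (t • x)‖ = G (t • x) from norm_norm _]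
      refine (ENNReal.ofReal_le_ofReal h1).trans_eq ?_
      rw [ENNReal.ofReal_mul (by positivity), ENNReal.ofReal_pow (by positivity)]
      norm_num
    · filter_upwards [lt_mem_nhds (show R < R + 1 by linarith)] with t ht
      refine huR _ ?_
      rw [norm_smul, Real.norm_of_nonneg (hR.le.trans ht.le)]
      nlinarith [(hA x hx).1]
  have hin : ∀ t ∈ Set.Ioc 0 (R + 1), ∫⁻ x in A, ‖G (t • x)‖ₑ ∂μ ≤
      ENNReal.ofReal (t ^ (-d)) * (S * N) := by
    intro t ht
    have hc : Continuous fun x => G (t • x) := hGc.comp (continuous_const_smul t)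
    have h1 := eLpNorm_le_eLpNorm_mul_rpow_measure_univ (μ := μ.restrict A)
      (p := 1) (q := ENNReal.ofReal p) (ENNReal.one_le_ofReal.2 hp.le)
      hc.aestronglyMeasurable
    rw [eLpNorm_one_eq_lintegral_enorm, Measure.restrict_apply_univ, ENNReal.toReal_one, div_one,
      ENNReal.toReal_ofReal hp0.le] at h1
    refine h1.trans ?_
    have h2 := (eLpNorm_mono_measure (fun x => G (t • x)) (Measure.restrict_le_self (μ := μ)
      (s := A)) (p := ENNReal.ofReal p)).trans_eq (eLpNorm_comp_const_smul μ hGc hp0 ht.1)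
    calc _ ≤ ENNReal.ofReal (t ^ (-d)) * N * S := by gcongr
      _ = _ := by ring
  have hmain : μ A * ‖u 0‖ₑ ≤ J * (3 ^ (k + 1) * S) * N := by
    calc μ A * ‖u 0‖ₑ = ∫⁻ _ in A, ‖u 0‖ₑ ∂μ := by rw [setLIntegral_const, mul_comm]
      _ ≤ ∫⁻ x in A, (∫⁻ t in Set.Ioc 0 (R + 1),
            ENNReal.ofReal (t ^ k) * (3 ^ (k + 1) * ‖G (t • x)‖ₑ)) ∂μ :=
          setLIntegral_mono' measurableSet_ball hray
      _ = ∫⁻ t in Set.Ioc 0 (R + 1), ∫⁻ x in A,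
            ENNReal.ofReal (t ^ k) * (3 ^ (k + 1) * ‖G (t • x)‖ₑ) ∂μ :=
          lintegral_lintegral_swap (f := fun x t =>
            ENNReal.ofReal (t ^ k) * (3 ^ (k + 1) * ‖G (t • x)‖ₑ)) (by
              have hGm := hGc.measurable
              unfold Function.uncurry
              fun_prop)
      _ ≤ ∫⁻ t in Set.Ioc 0 (R + 1), ENNReal.ofReal (t ^ k) * ENNReal.ofReal (t ^ (-d)) *
            (3 ^ (k + 1) * S * N) := by
          refine setLIntegral_mono' measurableSet_Ioc fun t ht => ?_
          rw [lintegral_const_mul' _ _ ENNReal.ofReal_ne_top,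
            lintegral_const_mul' _ _ (by finiteness)]
          calc _ ≤ ENNReal.ofReal (t ^ k) * (3 ^ (k + 1) *
                (ENNReal.ofReal (t ^ (-d)) * (S * N))) := by gcongr; exact hin t ht
            _ = _ := by ring
      _ = _ := by rw [lintegral_mul_const _ (by fun_prop)]; ring
  calc ‖u 0‖ₑ = (μ A)⁻¹ * (μ A * ‖u 0‖ₑ) := by
        rw [← mul_assoc, ENNReal.inv_mul_cancel hA0 hAt, one_mul]
    _ ≤ (μ A)⁻¹ * (J * (3 ^ (k + 1) * S) * N) := by gcongr
    _ = _ := by ring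

end Measure

/-- A sum of functions with disjoint supports and `L^p`-norms at most `K` has `L^p`-norm at most
`K` times the `1 / p`-th power of the number of summands. -/
lemma eLpNorm_sum_le_of_disjoint_support {α ι G : Type*} [MeasurableSpace α]
    {μ : Measure α} [NormedAddCommGroup G] {f : ι → α → G} {s : Finset ι} {p : ℝ} (hp : 0 < p)
    (hf : ∀ i ∈ s, AEStronglyMeasurable (f i) μ)
    (hd : ∀ x, ∀ i ∈ s, ∀ j ∈ s, f i x ≠ 0 → f j x ≠ 0 → i = j) {K : ℝ≥0∞}
    (hK : ∀ i ∈ s, eLpNorm (f i) (ENNReal.ofReal p) μ ≤ K) :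
    eLpNorm (∑ i ∈ s, f i) (ENNReal.ofReal p) μ ≤ (s.card : ℝ≥0∞) ^ (1 / p) * K := by
  have hp' : ENNReal.ofReal p ≠ 0 := (ENNReal.ofReal_pos.2 hp).ne'
  have hint : ∀ i ∈ s, ∫⁻ x, ‖f i x‖ₑ ^ p ∂μ ≤ K ^ p := fun i hi => by
    have h := hK i hi
    rw [eLpNorm_eq_lintegral_rpow_enorm_toReal hp' ENNReal.ofReal_ne_top,
      ENNReal.toReal_ofReal hp.le, one_div, ENNReal.rpow_inv_le_iff hp] at h
    exact h
  rw [eLpNorm_eq_lintegral_rpow_enorm_toReal hp' ENNReal.ofReal_ne_top, ENNReal.toReal_ofReal hp.le]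
  have hpt : ∀ x, ‖(∑ i ∈ s, f i) x‖ₑ ^ p ≤ ∑ i ∈ s, ‖f i x‖ₑ ^ p := fun x => by
    rw [Finset.sum_apply]
    by_cases h : ∃ i ∈ s, f i x ≠ 0
    · obtain ⟨i, hi, hix⟩ := h
      rw [Finset.sum_eq_single_of_mem i hi fun j hj hji => by
        by_contra hjx
        exact hji (hd x j hj i hi hjx hix)]
      exact Finset.single_le_sum (f := fun i => ‖f i x‖ₑ ^ p) (fun _ _ => zero_le) hi
    · push Not at h
      rw [Finset.sum_eq_zero h]
      simp [hp]
  calc (∫⁻ x, ‖(∑ i ∈ s, f i) x‖ₑ ^ p ∂μ) ^ (1 / p)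
      ≤ (∑ i ∈ s, K ^ p) ^ (1 / p) := by
        refine ENNReal.rpow_le_rpow ?_ (by positivity)
        refine (lintegral_mono hpt).trans ?_
        rw [lintegral_finsetSum' _ fun i hi => (hf i hi).enorm.pow_const p]
        exact Finset.sum_le_sum hint
    _ = _ := by
        rw [Finset.sum_const, nsmul_eq_mul, ENNReal.mul_rpow_of_nonneg _ _ (by positivity),
          ← ENNReal.rpow_mul, mul_one_div_cancel hp.ne', ENNReal.rpow_one]

section Measure

variable {E : Type*} [NormedAddCommGroup E] [NormedSpace ℝ E] [MeasurableSpace E] [BorelSpace E]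
  [FiniteDimensional ℝ E] (μ : Measure E) [μ.IsAddHaarMeasure]

lemma eLpNorm_iteratedFDeriv_comp_const_smul {f : E → ℝ} (hf : ContDiff ℝ ∞ f) (k : ℕ) {p : ℝ}
    (hp : 0 < p) {c : ℝ} (hc : 0 < c) :
    eLpNorm (fun x => ‖iteratedFDeriv ℝ k (fun y => f (c • y)) x‖) (ENNReal.ofReal p) μ =
      ENNReal.ofReal (c ^ (k - Module.finrank ℝ E / p : ℝ)) *
        eLpNorm (fun x => ‖iteratedFDeriv ℝ k f x‖) (ENNReal.ofReal p) μ := by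
  have h : (fun x => ‖iteratedFDeriv ℝ k (fun y => f (c • y)) x‖) =
      (c ^ k) • fun x => ‖iteratedFDeriv ℝ k f (c • x)‖ := by
    ext x
    rw [norm_iteratedFDeriv_comp_const_smul hf, abs_of_pos hc]
    rfl
  rw [h, eLpNorm_const_smul,
    eLpNorm_comp_const_smul μ (continuous_norm_iteratedFDeriv hf k) hp hc, ← mul_assoc,
    Real.enorm_of_nonneg (by positivity), ← ENNReal.ofReal_mul (by positivity),
    ← Real.rpow_natCast, ← Real.rpow_add hc, sub_eq_add_neg]

/-- The capacity of a point vanishes for `m p ≤ n`: averages of a cutoff over `N`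
geometric scales have small Sobolev norm, since the derivatives at different scales have disjoint supports. -/
lemma exists_cutoff_eLpNorm_iteratedFDeriv_le {m : ℕ} (hm : 1 ≤ m) {p : ℝ} (hp : 1 < p)
    (hmp : (m : ℝ) * p ≤ Module.finrank ℝ E) {δ : ℝ≥0∞} (hδ : δ ≠ 0) :
    ∃ η : E → ℝ, ContDiff ℝ ∞ η ∧ HasCompactSupport η ∧ η =ᶠ[𝓝 0] 1 ∧ ∀ k ≤ m,
      eLpNorm (fun x => ‖iteratedFDeriv ℝ k η x‖) (ENNReal.ofReal p) μ ≤ δ := by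
  have hp0 : 0 < p := by linarith
  set d : ℝ := Module.finrank ℝ E / p with hd
  have hmd : (m : ℝ) ≤ d := (le_div_iff₀ hp0).2 hmp
  let b : ContDiffBump (0 : E) := ⟨1, 2, one_pos, one_lt_two⟩
  have hb : ContDiff ℝ ∞ b := b.contDiff
  set B : ℕ → E → ℝ := fun j x => b ((4 : ℝ) ^ j • x) with hB
  have hBc : ∀ j, ContDiff ℝ ∞ (B j) := fun j => hb.comp (by fun_prop)
  set T : ℕ → ℝ≥0∞ := fun k => eLpNorm (fun x => ‖iteratedFDeriv ℝ k b x‖) (ENNReal.ofReal p) μ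
  have hT : ∀ k, T k ≠ ⊤ := fun k =>
    ((continuous_norm_iteratedFDeriv hb k).memLp_of_hasCompactSupport
      (b.hasCompactSupport.iteratedFDeriv k).norm).2.ne
  set K : ℝ≥0∞ := 2 * ∑ k ∈ Finset.range (m + 1), T k with hK
  have hKt : K ≠ ⊤ := ENNReal.mul_ne_top (by simp) (ENNReal.sum_ne_top.2 fun k _ => hT k)
  have hTK : ∀ k ≤ m, 2 * T k ≤ K := fun k hk => by
    rw [hK]
    gcongr
    exact Finset.single_le_sum (f := T) (fun _ _ => zero_le) (Finset.mem_range.2 (by omega))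
  have hscale : ∀ j k : ℕ, eLpNorm (fun x => ‖iteratedFDeriv ℝ k (B j) x‖) (ENNReal.ofReal p) μ =
      ENNReal.ofReal (((4 : ℝ) ^ j) ^ (k - d : ℝ)) * T k := fun j k =>
    eLpNorm_iteratedFDeriv_comp_const_smul μ hb k hp0 (by positivity)
  have h4 : ∀ j : ℕ, (1 : ℝ) ≤ 4 ^ j := fun j => one_le_pow₀ (by norm_num)
  have hbound : ∀ N : ℕ, 1 ≤ N → ∀ k ≤ m,
      eLpNorm (fun x => ‖iteratedFDeriv ℝ k (fun y => ∑ j ∈ Finset.range N, B j y) x‖)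
        (ENNReal.ofReal p) μ ≤ (N : ℝ≥0∞) ^ (1 / p) * K := by
    intro N hN k hk
    rw [eLpNorm_norm, iteratedFDeriv_sum fun j _ => (hBc j).of_le (mod_cast le_top)]
    have hmeas : ∀ j ∈ Finset.range N, AEStronglyMeasurable (iteratedFDeriv ℝ k (B j)) μ :=
      fun j _ => ((hBc j).continuous_iteratedFDeriv (mod_cast le_top)).aestronglyMeasurable
    rcases Nat.eq_zero_or_pos k with rfl | hk0
    · refine (eLpNorm_sum_le hmeas (ENNReal.one_le_ofReal.2 hp.le)).trans ?_
      have h1 : ∀ j ∈ Finset.range N, eLpNorm (iteratedFDeriv ℝ 0 (B j)) (ENNReal.ofReal p) μ ≤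
          ENNReal.ofReal ((1 / 2) ^ j) * T 0 := fun j _ => by
        rw [← eLpNorm_norm, hscale]
        gcongr
        have : (1 : ℝ) ≤ m := mod_cast hm
        calc ((4 : ℝ) ^ j) ^ ((0 : ℕ) - d : ℝ) ≤ ((4 : ℝ) ^ j) ^ (-1 : ℝ) :=
              Real.rpow_le_rpow_of_exponent_le (h4 j) (by push_cast; linarith)
          _ = (1 / 4) ^ j := by rw [Real.rpow_neg_one, one_div, inv_pow]
          _ ≤ _ := by gcongr; norm_num
      refine (Finset.sum_le_sum h1).trans ?_
      rw [← Finset.sum_mul, ← ENNReal.ofReal_sum_of_nonneg fun _ _ => by positivity]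
      calc _ ≤ ENNReal.ofReal 2 * T 0 := by gcongr; exact sum_geometric_two_le N
        _ = 1 * (2 * T 0) := by simp
        _ ≤ _ := by
          gcongr
          · exact ENNReal.one_le_rpow (mod_cast hN) (by positivity)
          · exact hTK 0 hk
    · have h := eLpNorm_sum_le_of_disjoint_support hp0 hmeas (K := K) ?_ fun j _ => ?_
      · rwa [Finset.card_range] at h
      · have hmem : ∀ (x : E) (j : ℕ), iteratedFDeriv ℝ k (B j) x ≠ 0 →
            1 ≤ 4 ^ j * ‖x‖ ∧ 4 ^ j * ‖x‖ ≤ 2 := fun x j hx => by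
          have h1 : iteratedFDeriv ℝ k b ((4 : ℝ) ^ j • x) ≠ 0 := fun h0 => hx <| by
            rw [← norm_eq_zero, norm_iteratedFDeriv_comp_const_smul hb, h0]
            simp
          have h2 := b.norm_mem_Icc_of_iteratedFDeriv_ne_zero hk0.ne' h1
          rwa [norm_smul, Real.norm_of_nonneg (by positivity)] at h2
        have hlt : ∀ (x : E) (i j : ℕ), iteratedFDeriv ℝ k (B i) x ≠ 0 →
            iteratedFDeriv ℝ k (B j) x ≠ 0 → ¬ i < j := fun x i j hi hj hij => by
          have h1 := (hmem x i hi).1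
          have h2 := (hmem x j hj).2
          have h3 : (4 : ℝ) ^ (i + 1) ≤ 4 ^ j := pow_le_pow_right₀ (by norm_num) hij
          have h5 := mul_le_mul_of_nonneg_right h3 (norm_nonneg x)
          rw [pow_succ] at h5
          linarith
        intro x i _ j _ hi hj
        exact le_antisymm (not_lt.1 (hlt x j i hj hi)) (not_lt.1 (hlt x i j hi hj))
      · rw [← eLpNorm_norm, hscale]
        calc _ ≤ ENNReal.ofReal 1 * (2 * T k) := by
              gcongr
              · refine Real.rpow_le_one_of_one_le_of_nonpos (h4 j) ?_
                have : (k : ℝ) ≤ m := mod_cast hk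
                linarith
              · exact le_mul_of_one_le_left zero_le one_le_two
          _ ≤ K := by rw [ENNReal.ofReal_one, one_mul]; exact hTK k hk
  obtain ⟨N, hN1, hN⟩ : ∃ N : ℕ, 1 ≤ N ∧ ENNReal.ofReal ((N : ℝ) ^ (-(1 - 1 / p))) * K ≤ δ := by
    have hq : 0 < 1 - 1 / p := sub_pos.2 ((div_lt_one hp0).2 hp)
    have h1 := ENNReal.tendsto_ofReal
      ((tendsto_rpow_neg_atTop hq).comp tendsto_natCast_atTop_atTop)
    have h2 := ENNReal.Tendsto.mul_const (b := K) h1 (.inr hKt)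
    rw [ENNReal.ofReal_zero, zero_mul] at h2
    have h3 := h2.eventually_le_const hδ.bot_lt
    exact ((Filter.eventually_ge_atTop 1).and h3).exists
  have hN0 : (0 : ℝ) < N := mod_cast hN1
  have hsum : ContDiff ℝ ∞ fun y => ∑ j ∈ Finset.range N, B j y :=
    ContDiff.sum fun j _ => hBc j
  refine ⟨fun x => (N : ℝ)⁻¹ • ∑ j ∈ Finset.range N, B j x, hsum.const_smul _, ?_, ?_, ?_⟩
  · refine HasCompactSupport.intro (isCompact_closedBall (0 : E) 2) fun x hx => ?_
    rw [Finset.sum_eq_zero fun j _ => ?_, smul_zero]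
    refine b.zero_of_le_dist ?_
    rw [mem_closedBall_zero_iff, not_le] at hx
    rw [dist_zero_right, norm_smul, Real.norm_of_nonneg (by positivity)]
    change 2 ≤ _
    nlinarith [h4 j]
  · have h1 : ∀ j ∈ Finset.range N, ∀ᶠ x in 𝓝 (0 : E), B j x = 1 := fun j _ => by
      have h2 : Filter.Tendsto (fun x : E => (4 : ℝ) ^ j • x) (𝓝 0) (𝓝 0) := by
        have := (continuous_const_smul ((4 : ℝ) ^ j)).tendsto (0 : E)
        rwa [smul_zero] at this
      exact h2.eventually b.eventuallyEq_one
    filter_upwards [(Filter.eventually_all_finset _).2 h1] with x hx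
    rw [Finset.sum_congr rfl hx]
    simp [hN0.ne']
  · intro k hk
    refine le_trans ?_ hN
    have h1 : (fun x => ‖iteratedFDeriv ℝ k
        (fun x => (N : ℝ)⁻¹ • ∑ j ∈ Finset.range N, B j x) x‖) = (N : ℝ)⁻¹ •
          fun x => ‖iteratedFDeriv ℝ k (fun y => ∑ j ∈ Finset.range N, B j y) x‖ := by
      ext x
      rw [iteratedFDeriv_const_smul_apply' (hsum.contDiffAt.of_le (mod_cast le_top)), norm_smul,
        Real.norm_of_nonneg (by positivity)]
      rfl
    rw [h1, eLpNorm_const_smul]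
    calc _ ≤ ‖(N : ℝ)⁻¹‖ₑ * ((N : ℝ≥0∞) ^ (1 / p) * K) := by gcongr; exact hbound N hN1 k hk
      _ = _ := by
        rw [← mul_assoc, Real.enorm_of_nonneg (by positivity), ← ENNReal.ofReal_natCast,
          ENNReal.ofReal_rpow_of_pos hN0, ← ENNReal.ofReal_mul (by positivity),
          ← Real.rpow_neg_one, ← Real.rpow_add hN0]
        congr 3
        ring

end Measure

/-- Theorem B.4 (thm-density): `C_c^∞(ℝⁿ∖{0})` is dense in the Sobolev space
`W^{m,p}(ℝⁿ)` if and only if `p ≤ n/m`. -/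
theorem stmt17 (n m : ℕ) (hn : 1 ≤ n) (hm : 1 ≤ m) (p : ℝ) (hp1 : 1 < p) :
    p ≤ (n : ℝ) / (m : ℝ) ↔
      ∀ f : EuclideanSpace ℝ (Fin n) → ℝ, ContDiff ℝ (⊤ : ℕ∞) f → HasCompactSupport f →
        ∀ ε : ℝ, 0 < ε →
          ∃ g : EuclideanSpace ℝ (Fin n) → ℝ, ContDiff ℝ (⊤ : ℕ∞) g ∧ HasCompactSupport g ∧
            (0 : EuclideanSpace ℝ (Fin n)) ∉ tsupport g ∧
            ∑ k ∈ Finset.range (m + 1),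
                eLpNorm (fun x => ‖iteratedFDeriv ℝ k (fun y => f y - g y) x‖)
                  (ENNReal.ofReal p) volume
              < ENNReal.ofReal ε := by
  have hp : (1 : ℝ≥0∞) ≤ ENNReal.ofReal p := ENNReal.one_le_ofReal.2 hp1.le
  have hm0 : (0 : ℝ) < m := mod_cast hm
  rw [le_div_iff₀ hm0, mul_comm]
  constructor
  · intro hmp f hf hfc ε hε
    obtain ⟨M, hM⟩ := exists_eLpNorm_iteratedFDeriv_mul_le volume hf hfc m hp
    obtain ⟨δ, hδ0, hδ⟩ : ∃ δ : ℝ≥0∞, δ ≠ 0 ∧ (m + 1) * (M * ((m + 1) * δ)) < ENNReal.ofReal ε := by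
      have h : Filter.Tendsto (fun δ : ℝ≥0∞ => (m + 1) * (M * ((m + 1) * δ))) (𝓝[>] 0) (𝓝 0) := by
        have h1 : Filter.Tendsto (fun δ : ℝ≥0∞ => ((m + 1) * (M * (m + 1)) : ℝ≥0∞) * δ)
            (𝓝 0) (𝓝 (((m + 1) * (M * (m + 1)) : ℝ≥0∞) * 0)) :=
          ENNReal.Tendsto.const_mul Filter.tendsto_id (.inr (by finiteness))
        rw [mul_zero] at h1
        refine (h1.mono_left nhdsWithin_le_nhds).congr fun δ => by ring
      obtain ⟨δ, h1, h2⟩ := ((h.eventually_lt_const (ENNReal.ofReal_pos.2 hε)).and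
        self_mem_nhdsWithin).exists
      exact ⟨δ, (Set.mem_Ioi.1 h2).ne', h1⟩
    obtain ⟨η, hη, -, hη1, hηδ⟩ := exists_cutoff_eLpNorm_iteratedFDeriv_le
      (volume : Measure (EuclideanSpace ℝ (Fin n))) hm hp1 (by simpa using hmp) hδ0
    refine ⟨fun x => (1 - η x) * f x, (contDiff_const.sub hη).mul hf, hfc.mul_left, ?_, ?_⟩
    · rw [notMem_tsupport_iff_eventuallyEq]
      filter_upwards [hη1] with x hx
      simp [hx]
    · have hsub : (fun y => f y - (1 - η y) * f y) = fun y => η y * f y := by ext y; ring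
      rw [hsub]
      refine lt_of_le_of_lt ?_ hδ
      calc _ ≤ ∑ k ∈ Finset.range (m + 1), M * ((m + 1) * δ) := by
            refine Finset.sum_le_sum fun k hk =>
              (hM η hη k (by simpa [Nat.lt_succ_iff] using hk)).trans ?_
            gcongr
            refine (Finset.sum_le_sum fun i hi =>
              hηδ i (by simpa [Nat.lt_succ_iff] using hi)).trans_eq ?_
            simp
        _ = _ := by simp
  · intro h
    by_contra! hmp
    have : Nontrivial (EuclideanSpace ℝ (Fin n)) :=
      Module.nontrivial_of_finrank_pos (R := ℝ) (by rw [finrank_euclideanSpace_fin]; omega)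
    let f : ContDiffBump (0 : EuclideanSpace ℝ (Fin n)) := ⟨1, 2, one_pos, one_lt_two⟩
    obtain ⟨M, hM⟩ := exists_eLpNorm_iteratedFDeriv_mul_le volume f.contDiff
      f.hasCompactSupport m hp
    obtain ⟨C, hC, hCu⟩ := exists_enorm_apply_zero_le_eLpNorm
      (volume : Measure (EuclideanSpace ℝ (Fin n))) hm hp1 (by simpa using hmp) two_pos
    have hCM : C * M ≠ ⊤ := ENNReal.mul_ne_top hC ENNReal.coe_ne_top
    have hr : 0 < (C * M).toReal + 1 := by positivity
    obtain ⟨g, hg, -, hg0, hlt⟩ := h f f.contDiff f.hasCompactSupport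
      ((C * M).toReal + 1)⁻¹ (by positivity)
    have hfg : ContDiff ℝ ∞ fun y => f y - g y := f.contDiff.sub hg
    have h1 := hCu (fun y => (f y - g y) * f y) (hfg.mul f.contDiff) fun x hx => by
      rw [f.zero_of_le_dist (by simpa using hx), mul_zero]
    have hf0 : f 0 = 1 := f.eventuallyEq_one.eq_of_nhds
    simp only [hf0, image_eq_zero_of_notMem_tsupport hg0, sub_zero, mul_one, enorm_one] at h1
    have h2 : (1 : ℝ≥0∞) ≤ C * M * ENNReal.ofReal ((C * M).toReal + 1)⁻¹ := by
      refine h1.trans ?_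
      rw [mul_assoc]
      gcongr
      refine (hM _ hfg m le_rfl).trans ?_
      gcongr
    rw [← ENNReal.ofReal_toReal hCM, ← ENNReal.ofReal_mul (by positivity),
      ENNReal.toReal_ofReal (by positivity), ENNReal.one_le_ofReal, ← div_eq_mul_inv,
      one_le_div hr] at h2
    linarith
end
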